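/- arXiv:math/9805124 — 2 statements merged into one kernel-verified Lean document; each statement's English description precedes it below -/
import Mathlib

section
/- Let S be a bounded linear operator on the real Banach space ℓ¹ with matrix entries t_{ij} = (S f_j)_i. Suppose: (1) S is quasinilpotent (spectral radius 0); (2) S has no nontrivial closed invariant ideal; (3) the bounded operator S⁻ on ℓ¹ whose matrix entries are max(−t_{ij}, 0) is compact. Let M = |S| be the bounded operator on ℓ¹ whose matrix entries are |t_{ij}| (the modulus of S). Then r(M) > 0 and r(M) is an eigenvalue of M corresponding to a positive eigenvector: there exists x ∈ ℓ¹ with x_i ≥ 0 for all i, x ≠ 0, and M x = r(M) x. In particular, M has a nontrivial closed invariant subspace. -/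
open Filter Topology

local notation "ℓ¹" => lp (fun _ : ℕ => ℝ) 1

namespace EllOne

instance : Nontrivial ℓ¹ :=
  ⟨lp.single 1 0 (1 : ℝ), 0, fun h => by simpa using congrArg (fun x : ℓ¹ => x 0) h⟩

/-- An operator on `ℓ¹` is positive if it maps nonnegative sequences to nonnegative sequences. -/
def IsPos (T : ℓ¹ →L[ℝ] ℓ¹) : Prop :=
  ∀ x : ℓ¹, (∀ i, 0 ≤ x i) → ∀ i, 0 ≤ T x i

lemma IsPos.one : IsPos 1 := fun _ hx i => hx i

lemma IsPos.mul {T U : ℓ¹ →L[ℝ] ℓ¹} (hT : IsPos T) (hU : IsPos U) : IsPos (T * U) :=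
  fun x hx => hT (U x) (hU x hx)

lemma IsPos.pow {T : ℓ¹ →L[ℝ] ℓ¹} (hT : IsPos T) (n : ℕ) : IsPos (T ^ n) := by
  induction n with
  | zero => simpa using IsPos.one
  | succ n ih => rw [pow_succ]; exact ih.mul hT

lemma IsPos.smul {T : ℓ¹ →L[ℝ] ℓ¹} (hT : IsPos T) {c : ℝ} (hc : 0 ≤ c) : IsPos (c • T) :=
  fun x hx i => mul_nonneg hc (hT x hx i)

lemma IsPos.sum {s : Finset ℕ} {T : ℕ → ℓ¹ →L[ℝ] ℓ¹} (hT : ∀ n ∈ s, IsPos (T n)) :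
    IsPos (∑ n ∈ s, T n) := by
  intro x hx i
  rw [sum_apply, lp.coeFn_sum, Finset.sum_apply]
  exact Finset.sum_nonneg fun n hn => hT n hn x hx i

lemma continuous_apply (i : ℕ) : Continuous fun x : ℓ¹ => x i :=
  (lp.evalCLM ℝ (fun _ : ℕ => ℝ) 1 i).continuous

lemma IsPos.tsum {T : ℕ → ℓ¹ →L[ℝ] ℓ¹} (hT : ∀ n, IsPos (T n)) (hs : Summable T) :
    IsPos (∑' n, T n) := by
  intro x hx i
  have hc : Continuous fun U : ℓ¹ →L[ℝ] ℓ¹ => U x i :=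
    (continuous_apply i).comp (ContinuousLinearMap.apply ℝ ℓ¹ x).continuous
  exact ge_of_tendsto ((hc.tendsto _).comp hs.hasSum)
    (Eventually.of_forall fun s => IsPos.sum (s := s) (fun n _ => hT n) x hx i)

lemma hasSum_apply (T : ℓ¹ →L[ℝ] ℓ¹) (x : ℓ¹) (i : ℕ) :
    HasSum (fun j => x j * T (lp.single 1 j 1) i) (T x i) := by
  have h := lp.hasSum_single (p := 1) ENNReal.one_ne_top x
  have h2 := (h.mapL T).mapL (lp.evalCLM ℝ (fun _ : ℕ => ℝ) 1 i)
  have e : (fun j => x j * T (lp.single 1 j 1) i) =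
      fun j => lp.evalCLM ℝ (fun _ : ℕ => ℝ) 1 i (T (lp.single 1 j (x j))) := by
    funext j
    have : lp.single 1 j (x j) = x j • (lp.single 1 j (1 : ℝ) : ℓ¹) := by
      rw [← lp.single_smul]; simp
    rw [this, map_smul, map_smul]
    rfl
  rw [e]
  exact h2

lemma IsPos.of_entries {T : ℓ¹ →L[ℝ] ℓ¹} (h : ∀ i j, 0 ≤ T (lp.single 1 j 1) i) : IsPos T :=
  fun x hx i => (hasSum_apply T x i).nonneg fun j => mul_nonneg (hx j) (h i j)

lemma ext_entries {T U : ℓ¹ →L[ℝ] ℓ¹}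
    (h : ∀ i j, T (lp.single 1 j 1) i = U (lp.single 1 j 1) i) : T = U := by
  ext x i
  refine (hasSum_apply T x i).unique ?_
  simpa only [h] using hasSum_apply U x i

/-- The coordinatewise absolute value on `ℓ¹`. -/
noncomputable def absSeq (x : ℓ¹) : ℓ¹ :=
  ⟨fun i => |x i|, (lp.memℓp x).mono' fun i => by simp⟩

lemma absSeq_apply (x : ℓ¹) (i : ℕ) : absSeq x i = |x i| := rfl

lemma norm_le_norm {x y : ℓ¹} (h : ∀ i, |x i| ≤ |y i|) : ‖x‖ ≤ ‖y‖ :=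
  lp.norm_mono one_ne_zero h

lemma norm_absSeq (x : ℓ¹) : ‖absSeq x‖ = ‖x‖ :=
  le_antisymm (norm_le_norm fun i => by simp [absSeq_apply])
    (norm_le_norm fun i => by simp [absSeq_apply])

lemma IsPos.mono {T : ℓ¹ →L[ℝ] ℓ¹} (hT : IsPos T) {x y : ℓ¹} (h : ∀ i, x i ≤ y i) (i : ℕ) :
    T x i ≤ T y i := by
  have := hT (y - x) (fun i => by simpa using h i) i
  rw [map_sub] at this
  simpa using this

lemma IsPos.abs_apply_le {T : ℓ¹ →L[ℝ] ℓ¹} (hT : IsPos T) (x : ℓ¹) (i : ℕ) :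
    |T x i| ≤ T (absSeq x) i := by
  refine abs_le'.2 ⟨hT.mono (fun i => le_abs_self _) i, ?_⟩
  have := hT.mono (x := -x) (y := absSeq x) (fun i => neg_le_abs _) i
  simpa using this

lemma IsPos.norm_apply_le {T : ℓ¹ →L[ℝ] ℓ¹} (hT : IsPos T) (x : ℓ¹) :
    ‖T x‖ ≤ ‖T (absSeq x)‖ :=
  norm_le_norm fun i => (hT.abs_apply_le x i).trans (le_abs_self _)

lemma IsPos.norm_le {T U : ℓ¹ →L[ℝ] ℓ¹} (hT : IsPos T) (h : IsPos (U - T)) : ‖T‖ ≤ ‖U‖ := by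
  refine T.opNorm_le_bound (norm_nonneg _) fun x => (hT.norm_apply_le x).trans ?_
  rw [← norm_absSeq x]
  refine le_trans (norm_le_norm fun i => ?_) (U.le_opNorm _)
  have hx : ∀ i, 0 ≤ absSeq x i := fun i => abs_nonneg _
  have h1 : 0 ≤ U (absSeq x) i - T (absSeq x) i := h _ hx i
  rw [abs_of_nonneg (hT _ hx i)]
  exact (by linarith : T (absSeq x) i ≤ U (absSeq x) i).trans (le_abs_self _)

/-- The geometric series of `c⁻¹ • T` converges when `c` exceeds the spectral radius of `T`. -/
lemma summable_smul_pow {A : Type*} [NormedRing A] [NormedAlgebra ℝ A] [CompleteSpace A]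
    {T : A} {ρ c : ℝ} (h : Tendsto (fun n : ℕ => ‖T ^ n‖ ^ (1 / (n : ℝ))) atTop (𝓝 ρ))
    (hρ : 0 ≤ ρ) (hc : ρ < c) : Summable fun n : ℕ => (c⁻¹ • T) ^ n := by
  obtain ⟨d, hd, hdc⟩ := exists_between hc
  have hd0 : 0 < d := hρ.trans_lt hd
  have hc0 : 0 < c := hd0.trans hdc
  have hq : d / c < 1 := (div_lt_one hc0).2 hdc
  refine Summable.of_norm_bounded_eventually_nat
    (summable_geometric_of_lt_one (by positivity) hq) ?_
  filter_upwards [h.eventually_lt_const hd, eventually_ne_atTop 0] with n hn hn0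
  have h1 : ‖T ^ n‖ ≤ d ^ n := by
    have := pow_le_pow_left₀ (by positivity) hn.le n
    rwa [one_div, Real.rpow_inv_natCast_pow (norm_nonneg _) hn0] at this
  rw [smul_pow, norm_smul, norm_pow, norm_inv, Real.norm_of_nonneg hc0.le, div_pow, div_eq_inv_mul,
    inv_pow]
  gcongr

/-- If some power `T ^ (m + 1)` has powers growing at least geometrically, then the spectral radius
of `T` exists, is positive, and `r ^ n ≤ ‖T ^ n‖`. -/
lemma exists_pos_tendsto_root {A : Type*} [NormedRing A] [NormOneClass A] {T : A} {m : ℕ} {c : ℝ}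
    (hc : 0 < c) (h : ∀ k : ℕ, c ^ k ≤ ‖T ^ ((m + 1) * k)‖) :
    ∃ r : ℝ, 0 < r ∧ Tendsto (fun n : ℕ => ‖T ^ n‖ ^ (1 / (n : ℝ))) atTop (𝓝 r) ∧
      ∀ n, r ^ n ≤ ‖T ^ n‖ := by
  have hle : ∀ n, c ^ n ≤ ‖T ^ n‖ ^ (m + 1) := fun n =>
    (h n).trans (by rw [mul_comm, pow_mul]; exact norm_pow_le _ _)
  have hpos : ∀ n, 0 < ‖T ^ n‖ := fun n => by
    refine (norm_nonneg _).lt_of_ne fun h0 => ?_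
    have := hle n
    rw [← h0, zero_pow m.succ_ne_zero] at this
    exact absurd this (not_le.2 (pow_pos hc n))
  have hsub : Subadditive fun n => Real.log ‖T ^ n‖ := fun a b => by
    rw [← Real.log_mul (hpos a).ne' (hpos b).ne']
    exact Real.log_le_log (hpos _) (by rw [pow_add]; exact norm_mul_le _ _)
  have hbdd : BddBelow (Set.range fun n : ℕ => Real.log ‖T ^ n‖ / n) := by
    refine ⟨min 0 (Real.log c / (m + 1)), ?_⟩
    rintro _ ⟨n, rfl⟩
    rcases n.eq_zero_or_pos with rfl | hn
    · simp
    · refine (min_le_right _ _).trans ?_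
      have := Real.log_le_log (pow_pos hc n) (hle n)
      rw [Real.log_pow, Real.log_pow] at this
      push_cast at this
      have hn' : (0 : ℝ) < n := by exact_mod_cast hn
      rw [div_le_div_iff₀ (by positivity) hn']
      linarith
  refine ⟨Real.exp hsub.lim, Real.exp_pos _, ?_, fun n => ?_⟩
  · refine ((Real.continuous_exp.tendsto _).comp (hsub.tendsto_lim hbdd)).congr fun n => ?_
    rw [Function.comp_apply, Real.rpow_def_of_pos (hpos n), mul_one_div]
  · rcases n.eq_zero_or_pos with rfl | hn
    · simp
    · have := hsub.lim_le_div hbdd hn.ne'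
      have hn' : (0 : ℝ) < n := by exact_mod_cast hn
      rw [le_div_iff₀ hn'] at this
      rw [← Real.exp_nat_mul, mul_comm, ← Real.exp_log (hpos n)]
      exact Real.exp_le_exp.2 this

/-- For a positive operator, the square of the Neumann series dominates `(n + 1) T ^ n`. -/
lemma IsPos.norm_pow_le_tsum {T : ℓ¹ →L[ℝ] ℓ¹} (hT : IsPos T) (hs : Summable fun n : ℕ => T ^ n)
    (n : ℕ) : (n + 1) * ‖T ^ n‖ ≤ ‖∑' k, T ^ k‖ ^ 2 := by
  set G := ∑' k, T ^ k with hG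
  have hGpos : IsPos G := IsPos.tsum hT.pow hs
  have hdecomp : ∀ k, G - ∑ i ∈ Finset.range k, T ^ i = T ^ k * G := fun k => by
    rw [hG, ← hs.sum_add_tsum_nat_add k, add_sub_cancel_left, hs.sum_add_tsum_nat_add k,
      ← hs.tsum_mul_left]
    simp only [← pow_add, add_comm]
  have h1 : IsPos (G - ∑ k ∈ Finset.range (n + 1), T ^ k) := by
    rw [hdecomp]; exact (hT.pow _).mul hGpos
  have h2 : ∀ k ∈ Finset.range (n + 1), IsPos (T ^ k * G - T ^ n) := fun k hk => by
    have hkn : k ≤ n := Nat.lt_succ_iff.1 (Finset.mem_range.1 hk)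
    have h3 : IsPos (G - T ^ (n - k)) := by
      intro x hx i
      have hc : Continuous fun U : ℓ¹ →L[ℝ] ℓ¹ => U x i :=
        (continuous_apply i).comp (ContinuousLinearMap.apply ℝ ℓ¹ x).continuous
      refine sub_nonneg.2 (ge_of_tendsto ((hc.tendsto _).comp hs.hasSum) ?_)
      filter_upwards [eventually_ge_atTop {n - k}] with s hsub
      simp only [Function.comp_apply, sum_apply, lp.coeFn_sum, Finset.sum_apply]
      exact Finset.single_le_sum (f := fun j => (T ^ j) x i) (fun j _ => hT.pow j x hx i)
        (Finset.singleton_subset_iff.1 hsub)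
    have : T ^ k * G - T ^ n = T ^ k * (G - T ^ (n - k)) := by
      rw [mul_sub, ← pow_add, Nat.add_sub_cancel' hkn]
    rw [this]
    exact (hT.pow k).mul h3
  have h3 : IsPos (G ^ 2 - ((n : ℝ) + 1) • T ^ n) := by
    have e : G ^ 2 - ((n : ℝ) + 1) • T ^ n = (G - ∑ k ∈ Finset.range (n + 1), T ^ k) * G +
        ∑ k ∈ Finset.range (n + 1), (T ^ k * G - T ^ n) := by
      rw [Finset.sum_sub_distrib, ← Finset.sum_mul, Finset.sum_const, Finset.card_range,
        ← Nat.cast_smul_eq_nsmul ℝ, sub_mul, sq]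
      push_cast
      abel
    rw [e]
    exact fun x hx i => add_nonneg ((h1.mul hGpos) x hx i) (IsPos.sum h2 x hx i)
  have h4 := ((hT.pow n).smul (by positivity : (0 : ℝ) ≤ n + 1)).norm_le h3
  rw [norm_smul, Real.norm_of_nonneg (by positivity)] at h4
  exact h4.trans (norm_pow_le G 2)

/-- The spectral radius of a positive operator is an approximate eigenvalue with nonnegative
approximate eigenvectors. -/
lemma IsPos.exists_approx_eigenvector {T : ℓ¹ →L[ℝ] ℓ¹} (hT : IsPos T) {r : ℝ} (hr : 0 < r)
    (hlim : Tendsto (fun n : ℕ => ‖T ^ n‖ ^ (1 / (n : ℝ))) atTop (𝓝 r))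
    (hle : ∀ n, r ^ n ≤ ‖T ^ n‖) {ε : ℝ} (hε : 0 < ε) :
    ∃ u : ℓ¹, (∀ i, 0 ≤ u i) ∧ ‖u‖ = 1 ∧ ‖r • u - T u‖ < ε := by
  by_contra! hcon
  have hcon' : ∀ w : ℓ¹, (∀ i, 0 ≤ w i) → ε * ‖w‖ ≤ ‖r • w - T w‖ := fun w hw => by
    rcases eq_or_ne w 0 with rfl | h0
    · simp
    have hn : 0 < ‖w‖ := norm_pos_iff.2 h0
    have := hcon (‖w‖⁻¹ • w) (fun i => mul_nonneg (by positivity) (hw i))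
      (by rw [norm_smul, norm_inv, norm_norm, inv_mul_cancel₀ hn.ne'])
    rw [map_smul, smul_comm, ← smul_sub, norm_smul, norm_inv, norm_norm, inv_mul_eq_div,
      le_div_iff₀ hn] at this
    exact this
  set C : ℝ := 2 * (r + ε) / ε
  have hbound : ∀ c, r < c → c < r + ε / 2 → ∀ n : ℕ, (n + 1) * (r / c) ^ n ≤ C ^ 2 := by
    intro c hrc hcε n
    have hc : 0 < c := hr.trans hrc
    have hs := summable_smul_pow hlim hr.le hrc
    have hpos : IsPos (c⁻¹ • T) := hT.smul (by positivity)
    have hG := hpos.norm_pow_le_tsum hs n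
    have hinv := hs.one_sub_mul_tsum_pow
    have hGpos : IsPos (∑' k, (c⁻¹ • T) ^ k) := IsPos.tsum hpos.pow hs
    set G := ∑' k, (c⁻¹ • T) ^ k
    have hGC : ‖G‖ ≤ C := by
      refine G.opNorm_le_bound (by positivity) fun y => (hGpos.norm_apply_le y).trans ?_
      rw [← norm_absSeq y]
      set w := G (absSeq y)
      have hw : c • w - T w = c • absSeq y := by
        have := congrArg (fun U : ℓ¹ →L[ℝ] ℓ¹ => c • U (absSeq y)) hinv
        simp only [mul_apply_eq_comp, sub_apply,
          one_apply_eq_self, smul_apply, smul_sub,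
          smul_inv_smul₀ hc.ne'] at this
        exact this
      have h1 := hcon' w (hGpos _ fun i => abs_nonneg _)
      have h2 : r • w - T w = c • absSeq y - (c - r) • w := by
        rw [← hw, sub_smul]; abel
      rw [h2] at h1
      have h3 := h1.trans (norm_sub_le _ _)
      rw [norm_smul, norm_smul, Real.norm_of_nonneg hc.le,
        Real.norm_of_nonneg (sub_nonneg.2 hrc.le)] at h3
      have h4 : (c - r) * ‖w‖ ≤ ε / 2 * ‖w‖ := by gcongr; linarith
      have h5 : c * ‖absSeq y‖ ≤ (r + ε) * ‖absSeq y‖ := by gcongr; linarith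
      have h6 : ‖w‖ * ε ≤ 2 * (r + ε) * ‖absSeq y‖ := by nlinarith
      rw [div_mul_eq_mul_div, le_div_iff₀ hε]
      exact h6
    refine le_trans ?_ (hG.trans (pow_le_pow_left₀ (norm_nonneg _) hGC 2))
    gcongr
    rw [smul_pow, norm_smul, norm_pow, norm_inv, Real.norm_of_nonneg hc.le, div_pow,
      div_eq_inv_mul, inv_pow]
    gcongr
    exact hle n
  have hall : ∀ n : ℕ, (n : ℝ) + 1 ≤ C ^ 2 := fun n => by
    have ht : Tendsto (fun c : ℝ => ((n : ℝ) + 1) * (r / c) ^ n) (𝓝[>] r) (𝓝 (n + 1)) := by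
      have : ContinuousAt (fun c : ℝ => ((n : ℝ) + 1) * (r / c) ^ n) r :=
        continuousAt_const.mul ((continuousAt_const.div continuousAt_id hr.ne').pow n)
      have h2 := this.tendsto
      simp only [div_self hr.ne', one_pow, mul_one] at h2
      exact h2.mono_left nhdsWithin_le_nhds
    refine le_of_tendsto ht ?_
    filter_upwards [Ioo_mem_nhdsGT (by linarith : r < r + ε / 2)] with c hc
    exact hbound c hc.1 hc.2 n
  obtain ⟨n, hn⟩ := exists_nat_gt (C ^ 2)
  linarith [hall n]

/-- The closed ideal of sequences supported in `A`. -/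
noncomputable def supportedIn (A : Set ℕ) : Submodule ℝ ℓ¹ where
  carrier := {x | ∀ k ∉ A, x k = 0}
  add_mem' hx hy k hk := by simp [hx k hk, hy k hk]
  zero_mem' k _ := by simp
  smul_mem' c x hx k hk := by simp [hx k hk]

lemma mem_supportedIn {A : Set ℕ} {x : ℓ¹} : x ∈ supportedIn A ↔ ∀ k ∉ A, x k = 0 := Iff.rfl

lemma isClosed_supportedIn (A : Set ℕ) : IsClosed (supportedIn A : Set ℓ¹) := by
  have : (supportedIn A : Set ℓ¹) = ⋂ k ∈ Aᶜ, {x : ℓ¹ | x k = 0} := by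
    ext x; simp [mem_supportedIn]
  rw [this]
  exact isClosed_biInter fun k _ => isClosed_eq (continuous_apply k) continuous_const

lemma single_mem_supportedIn {A : Set ℕ} {j : ℕ} :
    (lp.single 1 j (1 : ℝ) : ℓ¹) ∈ supportedIn A ↔ j ∈ A := by
  refine ⟨fun h => by_contra fun hj => ?_, fun h k hk => ?_⟩
  · simpa using h j hj
  · exact lp.single_apply_ne 1 j 1 (ne_of_mem_of_not_mem h hk).symm

/-- For an ideal irreducible operator, a set of indices closed under the directed graph of the
matrix is trivial. -/
lemma eq_empty_or_univ_of_closed {S : ℓ¹ →L[ℝ] ℓ¹}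
    (hni : ¬ ∃ J : Submodule ℝ ℓ¹,
      IsClosed (J : Set ℓ¹) ∧ J ≠ ⊥ ∧ J ≠ ⊤ ∧ (∀ x ∈ J, S x ∈ J) ∧
      (∀ x ∈ J, ∀ y : ℓ¹, (∀ i, |y i| ≤ |x i|) → y ∈ J))
    {A : Set ℕ} (hA : ∀ j ∈ A, ∀ k ∉ A, S (lp.single 1 j 1) k = 0) : A = ∅ ∨ A = Set.univ := by
  by_contra! hne
  obtain ⟨⟨a, ha⟩, h2⟩ := hne
  obtain ⟨b, hb⟩ := (Set.ne_univ_iff_exists_notMem A).1 h2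
  refine hni ⟨supportedIn A, isClosed_supportedIn A, fun h => ?_, fun h => ?_, fun x hx k hk => ?_,
    fun x hx y hy k hk => ?_⟩
  · have := single_mem_supportedIn.2 ha
    rw [h, Submodule.mem_bot] at this
    simpa using congrArg (fun x : ℓ¹ => x a) this
  · exact hb (single_mem_supportedIn.1 (h ▸ Submodule.mem_top))
  · refine (hasSum_apply S x k).unique ?_
    convert hasSum_zero using 1
    funext j
    by_cases hj : j ∈ A
    · rw [hA j hj k hk, mul_zero]
    · rw [hx j hj, zero_mul]
  · have := hy k
    rw [hx k hk, abs_zero] at this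
    exact abs_nonpos_iff.1 this

lemma IsPos.mul_le_apply {T : ℓ¹ →L[ℝ] ℓ¹} (hT : IsPos T) {v : ℓ¹} (hv : ∀ i, 0 ≤ v i) (j k : ℕ) :
    v j * T (lp.single 1 j 1) k ≤ T v k := by
  refine le_hasSum (hasSum_apply T v k) j fun i _ => mul_nonneg (hv i) (hT _ (fun l => ?_) k)
  rw [lp.single_apply, Pi.single_apply]
  split_ifs <;> norm_num

lemma single_nonneg (j i : ℕ) : 0 ≤ (lp.single 1 j (1 : ℝ) : ℓ¹) i := by
  rw [lp.single_apply, Pi.single_apply]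
  split_ifs <;> norm_num

/-- The graph of the modulus of an ideal irreducible operator has a cycle through `0`. -/
lemma exists_pow_apply_pos {S M : ℓ¹ →L[ℝ] ℓ¹}
    (hni : ¬ ∃ J : Submodule ℝ ℓ¹,
      IsClosed (J : Set ℓ¹) ∧ J ≠ ⊥ ∧ J ≠ ⊤ ∧ (∀ x ∈ J, S x ∈ J) ∧
      (∀ x ∈ J, ∀ y : ℓ¹, (∀ i, |y i| ≤ |x i|) → y ∈ J))
    (hM : ∀ i j : ℕ, M (lp.single 1 j 1) i = |S (lp.single 1 j 1) i|) (hpos : IsPos M) :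
    ∃ m : ℕ, 0 < (M ^ (m + 1)) (lp.single 1 0 1) 0 := by
  set A : Set ℕ := {k | ∃ m : ℕ, 0 < (M ^ (m + 1)) (lp.single 1 0 1) k}
  have hA : ∀ j ∈ A, ∀ k ∉ A, S (lp.single 1 j 1) k = 0 := by
    rintro j ⟨m, hm⟩ k hk
    by_contra hne
    refine hk ⟨m + 1, ?_⟩
    rw [pow_succ']
    refine lt_of_lt_of_le (mul_pos hm ?_)
      (hpos.mul_le_apply ((hpos.pow (m + 1)) _ (single_nonneg 0)) j k)
    rw [hM]
    exact abs_pos.2 hne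
  rcases eq_empty_or_univ_of_closed hni hA with h | h
  · have h0 : ∀ k, S (lp.single 1 0 1) k = 0 := fun k => by
      by_contra hne
      have : k ∈ A := ⟨0, by rw [zero_add, pow_one, hM]; exact abs_pos.2 hne⟩
      simp [h] at this
    rcases eq_empty_or_univ_of_closed hni (A := {0})
      (fun j hj k _ => by rw [Set.mem_singleton_iff.1 hj]; exact h0 k) with h' | h'
    · exact absurd h' (Set.singleton_ne_empty 0)
    · have : (1 : ℕ) ∈ ({0} : Set ℕ) := h' ▸ Set.mem_univ 1
      simp at this
  · exact (h ▸ Set.mem_univ 0 : (0 : ℕ) ∈ A)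

lemma IsPos.pow_apply_single_le_norm {T : ℓ¹ →L[ℝ] ℓ¹} (hT : IsPos T) (j k : ℕ) :
    (T (lp.single 1 j 1) j) ^ k ≤ ‖T ^ k‖ := by
  have h : (T (lp.single 1 j 1) j) ^ k ≤ (T ^ k) (lp.single 1 j 1) j := by
    induction k with
    | zero => simp
    | succ k ih =>
      rw [pow_succ, pow_succ']
      refine le_trans ?_ (hT.mul_le_apply ((hT.pow k) _ (single_nonneg j)) j j)
      exact mul_le_mul_of_nonneg_right ih (hT _ (single_nonneg j) j)
  calc _ ≤ ‖(T ^ k) (lp.single 1 j 1) j‖ := h.trans (le_abs_self _)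
    _ ≤ ‖(T ^ k) (lp.single 1 j 1)‖ := lp.norm_apply_le_norm one_ne_zero _ _
    _ ≤ ‖T ^ k‖ * ‖(lp.single 1 j (1 : ℝ) : ℓ¹)‖ := (T ^ k).le_opNorm _
    _ = ‖T ^ k‖ := by rw [lp.norm_single one_pos, norm_one, mul_one]

/-- An approximate eigenvalue `r > 0` of a compact perturbation of a quasinilpotent operator, with
nonnegative approximate eigenvectors, is an eigenvalue with a nonnegative eigenvector. -/
lemma exists_eigenvector {S K : ℓ¹ →L[ℝ] ℓ¹}
    (hq : Tendsto (fun n : ℕ => ‖S ^ n‖ ^ (1 / (n : ℝ))) atTop (𝓝 0))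
    (hK : IsCompactOperator K) {r : ℝ} (hr : 0 < r)
    (h : ∀ ε > 0, ∃ u : ℓ¹, (∀ i, 0 ≤ u i) ∧ ‖u‖ = 1 ∧ ‖r • u - (S + K) u‖ < ε) :
    ∃ x : ℓ¹, (∀ i, 0 ≤ x i) ∧ x ≠ 0 ∧ (S + K) x = r • x := by
  choose u hu0 hu1 hu using fun n : ℕ => h (1 / ((n : ℝ) + 1)) (by positivity)
  have hlim : Tendsto (fun n => r • u n - (S + K) (u n)) atTop (𝓝 0) :=
    squeeze_zero_norm (fun n => (hu n).le) tendsto_one_div_add_atTop_nhds_zero_nat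
  obtain ⟨z, -, φ, hφ, hz⟩ := (hK.isCompact_closure_image_closedBall 1).tendsto_subseq
    (x := fun n => K (u n)) fun n => subset_closure ⟨u n, by simp [hu1], rfl⟩
  have hL := (summable_smul_pow hq le_rfl hr).tsum_pow_mul_one_sub
  set L := ∑' n, (r⁻¹ • S) ^ n
  have hLu : ∀ x : ℓ¹, r⁻¹ • L (r • x - S x) = x := fun x => by
    have := congrArg (fun U : ℓ¹ →L[ℝ] ℓ¹ => U x) hL
    simp only [mul_apply_eq_comp, sub_apply,
      one_apply_eq_self, smul_apply] at this
    rwa [← map_smul, smul_sub, inv_smul_smul₀ hr.ne']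
  have hconv : Tendsto (u ∘ φ) atTop (𝓝 (r⁻¹ • L (0 + z))) := by
    have h1 := (hlim.comp hφ.tendsto_atTop).add hz
    refine (((L.continuous.tendsto _).comp h1).const_smul r⁻¹).congr fun n => ?_
    refine Eq.trans ?_ (hLu (u (φ n)))
    simp only [Function.comp_apply, add_apply]
    congr 2
    abel
  set x := r⁻¹ • L (0 + z)
  refine ⟨x, fun i => ?_, fun hx => ?_, ?_⟩
  · exact ge_of_tendsto (((continuous_apply i).tendsto x).comp hconv)
      (Eventually.of_forall fun n => hu0 (φ n) i)
  · have h1 : ‖x‖ = 1 := tendsto_nhds_unique hconv.norm (by simp [hu1])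
    rw [hx, norm_zero] at h1
    exact zero_ne_one h1
  · have h1 : Tendsto (fun n => r • u (φ n) - (S + K) (u (φ n))) atTop (𝓝 (r • x - (S + K) x)) :=
      (hconv.const_smul r).sub (((S + K).continuous.tendsto x).comp hconv)
    exact (sub_eq_zero.1 (tendsto_nhds_unique h1 (hlim.comp hφ.tendsto_atTop))).symm

lemma span_singleton_ne_top (x : ℓ¹) : Submodule.span ℝ {x} ≠ ⊤ := by
  intro h
  obtain ⟨a, ha⟩ := Submodule.mem_span_singleton.1
    (h ▸ Submodule.mem_top : (lp.single 1 0 (1 : ℝ) : ℓ¹) ∈ Submodule.span ℝ {x})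
  obtain ⟨b, hb⟩ := Submodule.mem_span_singleton.1
    (h ▸ Submodule.mem_top : (lp.single 1 1 (1 : ℝ) : ℓ¹) ∈ Submodule.span ℝ {x})
  have h00 : a * x 0 = 1 := by simpa using congrArg (fun y : ℓ¹ => y 0) ha
  have h01 : a * x 1 = 0 := by simpa using congrArg (fun y : ℓ¹ => y 1) ha
  have h11 : b * x 1 = 1 := by simpa using congrArg (fun y : ℓ¹ => y 1) hb
  rcases mul_eq_zero.1 h01 with h | h <;> simp [h] at h00 h11

end EllOne

/-- If `S` is a quasinilpotent operator on `ℓ¹` with no nontrivial closed invariant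
ideal and whose negative part `S⁻` is compact, then the spectral radius `r(|S|)` of the
modulus `|S|` is a strictly positive eigenvalue of `|S|` corresponding to a positive
eigenvector; in particular `|S|` has a nontrivial closed invariant subspace. -/
theorem modulus_of_quasinilpotent_has_positive_eigenvector
    (S Sneg M : lp (fun _ : ℕ => ℝ) 1 →L[ℝ] lp (fun _ : ℕ => ℝ) 1)
    -- `S` is quasinilpotent
    (hq : Tendsto (fun n : ℕ => ‖S ^ n‖ ^ (1 / (n : ℝ))) atTop (nhds 0))
    -- `S` has no nontrivial closed invariant ideal
    (hni : ¬ ∃ J : Submodule ℝ (lp (fun _ : ℕ => ℝ) 1),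
      IsClosed (J : Set (lp (fun _ : ℕ => ℝ) 1)) ∧ J ≠ ⊥ ∧ J ≠ ⊤ ∧
      (∀ x ∈ J, S x ∈ J) ∧
      (∀ x ∈ J, ∀ y : lp (fun _ : ℕ => ℝ) 1, (∀ i, |y i| ≤ |x i|) → y ∈ J))
    -- `Sneg` is the negative part `S⁻`, and it is compact
    (hneg : ∀ i j : ℕ, Sneg (lp.single 1 j 1) i = max (-(S (lp.single 1 j 1) i)) 0)
    (hcpt : IsCompactOperator Sneg)
    -- `M` is the modulus `|S|`
    (hM : ∀ i j : ℕ, M (lp.single 1 j 1) i = |S (lp.single 1 j 1) i|) :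
    ∃ r : ℝ, Tendsto (fun n : ℕ => ‖M ^ n‖ ^ (1 / (n : ℝ))) atTop (nhds r) ∧ 0 < r ∧
      (∃ x : lp (fun _ : ℕ => ℝ) 1, (∀ i, 0 ≤ x i) ∧ x ≠ 0 ∧ M x = r • x) ∧
      (∃ J : Submodule ℝ (lp (fun _ : ℕ => ℝ) 1),
        IsClosed (J : Set (lp (fun _ : ℕ => ℝ) 1)) ∧ J ≠ ⊥ ∧ J ≠ ⊤ ∧
        ∀ x ∈ J, M x ∈ J) := by
  have hpos : EllOne.IsPos M := .of_entries fun i j => by rw [hM]; exact abs_nonneg _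
  have hdecomp : M = S + (2 : ℝ) • Sneg := EllOne.ext_entries fun i j => by
    change M (lp.single 1 j 1) i = S (lp.single 1 j 1) i + 2 * Sneg (lp.single 1 j 1) i
    rw [hM, hneg]
    rcases le_total 0 (S (lp.single 1 j 1) i) with h | h
    · rw [abs_of_nonneg h, max_eq_right (by linarith)]; ring
    · rw [abs_of_nonpos h, max_eq_left (by linarith)]; ring
  obtain ⟨m, hm⟩ := EllOne.exists_pow_apply_pos hni hM hpos
  obtain ⟨r, hr, hlim, hle⟩ := EllOne.exists_pos_tendsto_root (T := M) hm fun k => by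
    rw [pow_mul]; exact (hpos.pow (m + 1)).pow_apply_single_le_norm 0 k
  have hcpt' : IsCompactOperator ((2 : ℝ) • Sneg) := by
    rw [FunLike.coe_smul]; exact hcpt.smul (2 : ℝ)
  obtain ⟨x, hx0, hx, hMx⟩ := EllOne.exists_eigenvector hq hcpt' hr fun ε hε =>
    hdecomp ▸ hpos.exists_approx_eigenvector hr hlim hle hε
  rw [← hdecomp] at hMx
  refine ⟨r, hlim, hr, ⟨x, hx0, hx, hMx⟩, Submodule.span ℝ {x},
    Submodule.closed_of_finiteDimensional _, by simpa using hx, EllOne.span_singleton_ne_top x,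
    fun y hy => ?_⟩
  obtain ⟨a, rfl⟩ := Submodule.mem_span_singleton.1 hy
  rw [map_smul, hMx]
  exact Submodule.smul_mem _ _ (Submodule.smul_mem _ _ (Submodule.mem_span_singleton_self x))
end

section
/- There exists a bounded linear operator T on the real Banach space ℓ¹ such that: (1) T is quasinilpotent (its spectral radius is 0); (2) T has no nontrivial closed invariant subspace (no closed linear subspace J with J ≠ {0}, J ≠ ℓ¹ and T(J) ⊆ J); and (3) the operator T⁻ on ℓ¹, whose matrix entries are max(−t_{ij}, 0) where t_{ij} = (T f_j)_i, is a compact operator. -/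
open Filter Topology

noncomputable section

namespace ReadOp

/-- The real Banach space `ℓ¹`. -/
abbrev L1 : Type := lp (fun _ : ℕ => ℝ) 1

/-- The standard unit vectors of `ℓ¹`. -/
def fv (i : ℕ) : L1 := lp.single 1 i 1

theorem fv_apply (i j : ℕ) : (fv i : L1) j = if j = i then 1 else 0 := by
  simp [fv, lp.single_apply, Pi.single_apply]

@[simp] theorem norm_fv (i : ℕ) : ‖fv i‖ = 1 := by
  simp [fv, lp.norm_single]

theorem L1_hasSum_norm (x : L1) : HasSum (fun i => |x i|) ‖x‖ := by
  have := lp.hasSum_norm (p := 1) (by norm_num) x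
  simpa using this

theorem L1_summable_abs (x : L1) : Summable (fun i => |x i|) := (L1_hasSum_norm x).summable

theorem L1_norm_eq (x : L1) : ‖x‖ = ∑' i, |x i| := (L1_hasSum_norm x).tsum_eq.symm

theorem L1_hasSum (x : L1) : HasSum (fun i => x i • fv i) x := by
  have := lp.hasSum_single (E := fun _ : ℕ => ℝ) (p := 1) (by norm_num) x
  convert this using 2 with i
  rw [fv, ← lp.single_smul]
  simp

theorem summable_smul_of_bdd {E : Type*} [NormedAddCommGroup E] [NormedSpace ℝ E] [CompleteSpace E]
    {u : ℕ → E} {K : ℝ} (hu : ∀ i, ‖u i‖ ≤ K) (x : L1) : Summable (fun i => x i • u i) := by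
  refine Summable.of_norm_bounded (g := fun i => |x i| * K) ((L1_summable_abs x).mul_right K) ?_
  intro i
  rw [norm_smul, Real.norm_eq_abs]
  exact mul_le_mul_of_nonneg_left (hu i) (abs_nonneg _)

/-- The bounded operator on `ℓ¹` with prescribed (bounded) values on unit vectors. -/
def lift {E : Type*} [NormedAddCommGroup E] [NormedSpace ℝ E] [CompleteSpace E]
    (u : ℕ → E) (K : ℝ) (hu : ∀ i, ‖u i‖ ≤ K) : L1 →L[ℝ] E :=
  LinearMap.mkContinuous
    { toFun := fun x => ∑' i, x i • u i
      map_add' := fun x y => by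
        rw [← (summable_smul_of_bdd hu x).tsum_add (summable_smul_of_bdd hu y)]
        simp [add_smul]
      map_smul' := fun r x => by
        simp only [RingHom.id_apply]
        rw [← (summable_smul_of_bdd hu x).tsum_const_smul]
        simp [mul_smul] } K
    (fun x => by
      simp only [LinearMap.coe_mk, AddHom.coe_mk]
      refine tsum_of_norm_bounded (g := fun i => K * |x i|) ((L1_hasSum_norm x).mul_left K) ?_
      intro i
      rw [norm_smul, Real.norm_eq_abs, mul_comm]
      exact mul_le_mul_of_nonneg_right (hu i) (abs_nonneg _))

theorem lift_fv {E : Type*} [NormedAddCommGroup E] [NormedSpace ℝ E] [CompleteSpace E]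
    (u : ℕ → E) (K : ℝ) (hu : ∀ i, ‖u i‖ ≤ K) (i : ℕ) : lift u K hu (fv i) = u i := by
  change ∑' j, (fv i) j • u j = u i
  rw [tsum_eq_single i]
  · simp [fv_apply]
  · intro j hj
    simp [fv_apply, hj]

theorem clm_hasSum {E : Type*} [NormedAddCommGroup E] [NormedSpace ℝ E]
    (S : L1 →L[ℝ] E) (x : L1) : HasSum (fun i => x i • S (fv i)) (S x) := by
  have := (L1_hasSum x).mapL S
  simpa using this

theorem norm_clm_le_tsum {E : Type*} [NormedAddCommGroup E] [NormedSpace ℝ E]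
    (S : L1 →L[ℝ] E) (x : L1) {g : ℕ → ℝ} (hg : Summable g)
    (h : ∀ i, |x i| * ‖S (fv i)‖ ≤ g i) : ‖S x‖ ≤ ∑' i, g i := by
  rw [← (clm_hasSum S x).tsum_eq]
  refine tsum_of_norm_bounded hg.hasSum ?_
  intro i
  rw [norm_smul, Real.norm_eq_abs]
  exact h i

theorem norm_clm_apply_le {E : Type*} [NormedAddCommGroup E] [NormedSpace ℝ E]
    (S : L1 →L[ℝ] E) {K : ℝ} (h : ∀ i, ‖S (fv i)‖ ≤ K) (x : L1) : ‖S x‖ ≤ K * ‖x‖ := by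
  rw [L1_norm_eq, ← tsum_mul_left]
  refine norm_clm_le_tsum S x ((L1_summable_abs x).mul_left K) ?_
  intro i
  rw [mul_comm]
  exact mul_le_mul_of_nonneg_right (h i) (abs_nonneg _)

theorem norm_clm_le {E : Type*} [NormedAddCommGroup E] [NormedSpace ℝ E]
    (S : L1 →L[ℝ] E) {K : ℝ} (h : ∀ i, ‖S (fv i)‖ ≤ K) : ‖S‖ ≤ K :=
  S.opNorm_le_bound ((norm_nonneg _).trans (h 0)) (norm_clm_apply_le S h)

theorem clm_ext {E : Type*} [NormedAddCommGroup E] [NormedSpace ℝ E]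
    {S S' : L1 →L[ℝ] E} (h : ∀ i, S (fv i) = S' (fv i)) : S = S' := by
  ext x
  have h1 := clm_hasSum S x
  simp only [h] at h1
  exact h1.unique (clm_hasSum S' x)

theorem eq_top_of_fv_mem {J : Submodule ℝ L1} (hJ : IsClosed (J : Set L1))
    (h : ∀ i, fv i ∈ J) : J = ⊤ := by
  rw [eq_top_iff]
  intro x _
  have := L1_hasSum x
  exact hJ.mem_of_tendsto this (Eventually.of_forall fun s =>
    J.sum_mem fun i _ => J.smul_mem _ (h i))

/-- Coordinate functionals. -/
def coord (j : ℕ) : L1 →L[ℝ] ℝ :=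
  lift (fun i => if j = i then 1 else 0) 1 (fun i => by split_ifs <;> simp)

theorem coord_fv (j i : ℕ) : coord j (fv i) = if j = i then 1 else 0 := lift_fv _ _ _ _

theorem coord_apply (j : ℕ) (x : L1) : coord j x = x j := by
  rw [← (clm_hasSum (coord j) x).tsum_eq, tsum_eq_single j]
  · simp [coord_fv]
  · intro i hi
    simp [coord_fv, hi.symm]

/-- Truncated convolution. -/
def conv (M : ℕ) (q c : ℕ → ℝ) (m : ℕ) : ℝ :=
  ∑ i ∈ Finset.range (M + 1), if i ≤ m then q i * c (m - i) else 0

theorem exists_conv_eq {M n : ℕ} (c : ℕ → ℝ) (h : ∃ j ≤ n, c j ≠ 0) :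
    ∃ q : ℕ → ℝ, ∀ m ≤ M, conv M q c m = if m = n then 1 else 0 := by
  classical
  set j0 := Nat.find h with hj0
  have hj0s : j0 ≤ n ∧ c j0 ≠ 0 := Nat.find_spec h
  have hlt : ∀ j < j0, c j = 0 := by
    intro j hj
    by_contra hc
    exact Nat.find_min h hj ⟨by omega, hc⟩
  -- `c = X ^ j0 * d`
  let d : PowerSeries ℝ := PowerSeries.mk fun i => c (i + j0)
  have hd : PowerSeries.constantCoeff d ≠ 0 := by
    simp [d, hj0s.2]
  have hcd : PowerSeries.mk c = PowerSeries.X ^ j0 * d := by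
    ext i
    rw [PowerSeries.coeff_X_pow_mul']
    simp only [PowerSeries.coeff_mk, d]
    split_ifs with hi
    · congr 1; omega
    · exact hlt i (by omega)
  let Q : PowerSeries ℝ := PowerSeries.X ^ (n - j0) * d⁻¹
  have hQ : Q * PowerSeries.mk c = PowerSeries.X ^ n := by
    rw [hcd]
    have : d⁻¹ * d = 1 := PowerSeries.inv_mul_cancel d hd
    calc PowerSeries.X ^ (n - j0) * d⁻¹ * (PowerSeries.X ^ j0 * d)
        = PowerSeries.X ^ (n - j0) * PowerSeries.X ^ j0 * (d⁻¹ * d) := by ring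
      _ = PowerSeries.X ^ n := by
        rw [this, mul_one, ← pow_add]; congr 1; omega
  refine ⟨fun i => PowerSeries.coeff i Q, fun m hm => ?_⟩
  have h1 := congrArg (PowerSeries.coeff m) hQ
  rw [PowerSeries.coeff_mul, PowerSeries.coeff_X_pow,
    Finset.Nat.sum_antidiagonal_eq_sum_range_succ_mk] at h1
  rw [← h1, conv, Finset.sum_ite, Finset.sum_const_zero, add_zero]
  have : (Finset.range (M + 1)).filter (fun i => i ≤ m) = Finset.range m.succ := by
    ext i; simp; omega
  rw [this]
  simp

/-- Extension by zero of a finite family of coefficients. -/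
def ext0 {M : ℕ} (c : Fin (M + 1) → ℝ) (j : ℕ) : ℝ :=
  if h : j < M + 1 then c ⟨j, h⟩ else 0

theorem continuous_ext0 {M : ℕ} (j : ℕ) : Continuous fun c : Fin (M + 1) → ℝ => ext0 c j := by
  unfold ext0
  split_ifs
  · fun_prop
  · fun_prop

theorem conv_congr {M : ℕ} {q c c' : ℕ → ℝ} (h : ∀ j ≤ M, c j = c' j) {m : ℕ} (hm : m ≤ M) :
    conv M q c m = conv M q c' m := by
  unfold conv
  refine Finset.sum_congr rfl fun i _ => ?_
  rw [h _ (by omega)]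

theorem exists_bounded_quasi_inverse (M n : ℕ) (hn : n ≤ M) (θ C ε : ℝ) (hθ : 0 < θ) (hε : 0 < ε) :
    ∃ D : ℝ, 0 ≤ D ∧ ∀ c : ℕ → ℝ, (∀ j ≤ M, |c j| ≤ C) → (∃ j ≤ n, θ ≤ |c j|) →
      ∃ q : ℕ → ℝ, ∑ i ∈ Finset.range (M + 1), |q i| ≤ D ∧
        ∑ m ∈ Finset.range (M + 1), |conv M q c m - if m = n then 1 else 0| ≤ ε := by
  classical
  let K : Set (Fin (M + 1) → ℝ) :=
    (Set.univ.pi fun _ => Set.Icc (-C) C) ∩ ⋃ j ∈ Finset.range (n + 1), {c | θ ≤ |ext0 c j|}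
  have hK : IsCompact K := by
    refine (isCompact_univ_pi fun _ => isCompact_Icc).inter_right ?_
    refine Set.Finite.isClosed_biUnion (Finset.finite_toSet _) fun j _ => ?_
    exact isClosed_le continuous_const (continuous_ext0 j).abs
  let P : Set (Fin (M + 1) → ℝ) → Prop := fun S => ∃ D : ℝ, 0 ≤ D ∧ ∀ c ∈ S,
    ∃ q : ℕ → ℝ, ∑ i ∈ Finset.range (M + 1), |q i| ≤ D ∧
        ∑ m ∈ Finset.range (M + 1), |conv M q (ext0 c) m - if m = n then 1 else 0| ≤ ε
  have hP : P K := by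
    refine hK.induction_on ⟨0, le_rfl, by simp⟩ ?_ ?_ ?_
    · rintro s t hst ⟨D, hD, h⟩
      exact ⟨D, hD, fun c hc => h c (hst hc)⟩
    · rintro s t ⟨D, hD, h⟩ ⟨D', hD', h'⟩
      refine ⟨max D D', le_max_of_le_left hD, fun c hc => ?_⟩
      rcases hc with hc | hc
      · obtain ⟨q, h1, h2⟩ := h c hc
        exact ⟨q, h1.trans (le_max_left _ _), h2⟩
      · obtain ⟨q, h1, h2⟩ := h' c hc
        exact ⟨q, h1.trans (le_max_right _ _), h2⟩
    · intro c hc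
      obtain ⟨j, hj, hcj⟩ : ∃ j ∈ Finset.range (n + 1), θ ≤ |ext0 c j| := by
        simpa using hc.2
      obtain ⟨q, hq⟩ := exists_conv_eq (M := M) (ext0 c)
        ⟨j, by simpa [Nat.lt_succ_iff] using hj, fun h => by rw [h, abs_zero] at hcj; linarith⟩
      let F : (Fin (M + 1) → ℝ) → ℝ := fun c' =>
        ∑ m ∈ Finset.range (M + 1), |conv M q (ext0 c') m - if m = n then 1 else 0|
      have hF : Continuous F := by
        refine continuous_finsetSum _ fun m _ => Continuous.abs (Continuous.sub ?_ continuous_const)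
        unfold conv
        refine continuous_finsetSum _ fun i _ => ?_
        split_ifs
        · exact continuous_const.mul (continuous_ext0 _)
        · exact continuous_const
      have hF0 : F c = 0 := by
        refine Finset.sum_eq_zero fun m hm => ?_
        rw [hq m (by simpa [Nat.lt_succ_iff] using hm), sub_self, abs_zero]
      refine ⟨{c' | F c' < ε}, ?_, ∑ i ∈ Finset.range (M + 1), |q i|,
        Finset.sum_nonneg fun _ _ => abs_nonneg _, fun c' hc' => ⟨q, le_rfl, le_of_lt hc'⟩⟩
      refine mem_nhdsWithin_of_mem_nhds ((isOpen_lt hF continuous_const).mem_nhds ?_)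
      simp [hF0, hε]
  obtain ⟨D, hD, h⟩ := hP
  refine ⟨D, hD, fun c hc ⟨j, hj, hcj⟩ => ?_⟩
  have key : ∀ j ≤ M, ext0 (fun i : Fin (M + 1) => c i) j = c j := by
    intro j hj
    simp [ext0, Nat.lt_succ_iff.2 hj]
  obtain ⟨q, h1, h2⟩ := h (fun i => c i) ⟨fun i _ => by
      have := abs_le.1 (hc i (by omega)); exact this, by
      simp only [Set.mem_iUnion]
      refine ⟨j, by simpa [Nat.lt_succ_iff] using hj, ?_⟩
      simp only [Set.mem_ofPred_eq]
      rwa [key j (hj.trans hn)]⟩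
  refine ⟨q, h1, le_trans (le_of_eq ?_) h2⟩
  refine Finset.sum_congr rfl fun m hm => ?_
  rw [conv_congr key (by simpa [Nat.lt_succ_iff] using hm)]

/-- Triangular numbers. -/
def tri : ℕ → ℕ
  | 0 => 0
  | p + 1 => tri p + p + 1

theorem tri_mono : Monotone tri := monotone_nat_of_le_succ fun p => by simp [tri]; omega

theorem tri_strictMono : StrictMono tri :=
  strictMono_nat_of_lt_succ fun p => by simp only [tri]; omega

/-- Enumeration of the pairs `(j, p)` with `p ≤ j`, with `p` decreasing in each block. -/
def st : ℕ → ℕ × ℕ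
  | 0 => (0, 0)
  | k + 1 => match st k with
    | (j, 0) => (j + 1, j + 1)
    | (j, p + 1) => (j, p)

theorem st_add_aux (j : ℕ) (h : st (tri j) = (j, j)) : ∀ r ≤ j, st (tri j + r) = (j, j - r) := by
  intro r
  induction r with
  | zero => intro _; simpa using h
  | succ r ih =>
    intro hr
    rw [← add_assoc, st, ih (by omega)]
    obtain ⟨m, hm⟩ : ∃ m, j - r = m + 1 := ⟨j - r - 1, by omega⟩
    rw [hm]
    simp only [Prod.mk.injEq, true_and]
    omega

theorem st_tri (j : ℕ) : st (tri j) = (j, j) := by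
  induction j with
  | zero => rfl
  | succ j ih =>
    have := st_add_aux j ih j le_rfl
    rw [tri, st, this]
    simp

theorem st_add {j r : ℕ} (h : r ≤ j) : st (tri j + r) = (j, j - r) :=
  st_add_aux j (st_tri j) r h

theorem exists_tri_add (k : ℕ) : ∃ j r, r ≤ j ∧ k = tri j + r := by
  induction k with
  | zero => exact ⟨0, 0, le_rfl, rfl⟩
  | succ k ih =>
    obtain ⟨j, r, h, rfl⟩ := ih
    rcases h.lt_or_eq with h | rfl
    · exact ⟨j, r + 1, h, by omega⟩
    · exact ⟨r + 1, 0, by omega, by simp [tri]⟩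

/-- The step whose initial block is copied at step `k`. -/
def src (k : ℕ) : ℕ := tri (st k).2

theorem src_add {j r : ℕ} (h : r ≤ j) : src (tri j + r) = tri (j - r) := by
  rw [src, st_add h]

theorem src_le (k : ℕ) : src k ≤ k := by
  obtain ⟨j, r, h, rfl⟩ := exists_tri_add k
  rw [src_add h]
  have := tri_mono (show j - r ≤ j by omega)
  omega

theorem exists_src_eq (p n : ℕ) : ∃ k, n ≤ k ∧ src k = tri p := by
  refine ⟨tri (p + n) + n, by omega, ?_⟩
  rw [src_add (by omega)]
  congr 1
  omega

theorem src_succ_of_lt {p k : ℕ} (h : tri p < src k) :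
    tri p ≤ src (k + 1) ∧ src (k + 1) ≤ k ∧ ∀ k', src k' ≠ k + 1 := by
  obtain ⟨j, r, hr, rfl⟩ := exists_tri_add k
  rw [src_add hr] at h
  have h1 : p < j - r := tri_strictMono.lt_iff_lt.1 h
  have e : tri j + r + 1 = tri j + (r + 1) := by ring
  rw [e, src_add (by omega)]
  refine ⟨tri_mono (by omega), ?_, ?_⟩
  · have := tri_mono (show j - (r + 1) ≤ j by omega)
    omega
  · intro k' hk'
    rw [src] at hk'
    have h2 : tri j < tri (st k').2 := by omega
    have h3 : tri (st k').2 < tri (j + 1) := by rw [hk', tri]; omega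
    have h4 := tri_strictMono.lt_iff_lt.1 h2
    have h5 := tri_strictMono.lt_iff_lt.1 h3
    omega

/-- End of the `k`-th step. -/
def N : ℕ → ℕ
  | 0 => 0
  | k + 1 => 3 * (4 * (N k + 1) + N (min (src k) k)) + 1
decreasing_by all_goals omega

/-- Start of the first fan. -/
def sa (k : ℕ) : ℕ := 4 * (N k + 1)
/-- The shift. -/
def ss (k : ℕ) : ℕ := 3 * (N k + 1)
/-- End of the first fan. -/
def M (k : ℕ) : ℕ := sa k + N (src k)
/-- The second shift. -/
def sb (k : ℕ) : ℕ := 2 * M k + 1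

theorem N_succ (k : ℕ) : N (k + 1) = 3 * M k + 1 := by
  rw [N, M, sa, min_eq_left (src_le k)]

theorem N_zero : N 0 = 0 := by rw [N]

theorem N_lt_succ (k : ℕ) : N k < N (k + 1) := by
  rw [N_succ, M, sa]; omega

theorem N_strictMono : StrictMono N := strictMono_nat_of_lt_succ N_lt_succ

theorem N_mono : Monotone N := N_strictMono.monotone

theorem le_N (k : ℕ) : k ≤ N k := N_strictMono.le_apply

theorem N_src_le (k : ℕ) : N (src k) ≤ N k := N_mono (src_le k)

/-- All the elementary relations between the constants of step `k`. -/
theorem consts (k : ℕ) : sa k = 4 * (N k + 1) ∧ ss k = 3 * (N k + 1) ∧ M k = sa k + N (src k) ∧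
    sb k = 2 * M k + 1 ∧ N (k + 1) = 3 * M k + 1 ∧ N (src k) ≤ N k :=
  ⟨rfl, rfl, rfl, rfl, N_succ k, N_src_le k⟩

/-- The step containing the index `i`. -/
def stp (i : ℕ) : ℕ := Nat.findGreatest (fun k => N k < i) i

theorem stp_spec {i : ℕ} (hi : 1 ≤ i) : N (stp i) < i ∧ i ≤ N (stp i + 1) := by
  have h1 : N (stp i) < i :=
    Nat.findGreatest_spec (P := fun k => N k < i) (Nat.zero_le i) (by simp [N_zero]; omega)
  refine ⟨h1, ?_⟩
  by_contra h
  push Not at h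
  have h2 : stp i + 1 ≤ i := (le_N _).trans h.le
  have := Nat.le_findGreatest (P := fun k => N k < i) h2 h
  change stp i + 1 ≤ stp i at this
  omega

theorem stp_eq {i k : ℕ} (h1 : N k < i) (h2 : i ≤ N (k + 1)) : stp i = k := by
  obtain ⟨h3, h4⟩ := stp_spec (i := i) (by omega)
  have h5 : stp i < k + 1 := N_strictMono.lt_iff_lt.1 (by omega)
  have h6 : k < stp i + 1 := N_strictMono.lt_iff_lt.1 (by omega)
  omega

/-- Indices lying in some fan. -/
def IsFan (i : ℕ) : Prop :=
  sa (stp i) ≤ i ∧ i ≤ M (stp i) ∨ sb (stp i) + ss (stp i) ≤ i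

/-- Layer indices. -/
def Lay (i : ℕ) : Prop := 1 ≤ i ∧ ¬ IsFan i

/-- `Fan σ p q`: a copy of `[p, q]` is placed at `σ`. -/
inductive Fan : ℕ → ℕ → ℕ → Prop
  | a (k : ℕ) : Fan (sa k) 0 (N (src k))
  | b (k : ℕ) : Fan (sb k + ss k) (ss k) (M k)

theorem isFan_iff {i k : ℕ} (h1 : N k < i) (h2 : i ≤ N (k + 1)) :
    IsFan i ↔ (sa k ≤ i ∧ i ≤ M k ∨ sb k + ss k ≤ i) := by
  rw [IsFan, stp_eq h1 h2]

theorem lay_iff {i k : ℕ} (h1 : N k < i) (h2 : i ≤ N (k + 1)) :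
    Lay i ↔ (i < sa k ∨ M k < i ∧ i < sb k + ss k) := by
  rw [Lay, isFan_iff h1 h2]
  have := consts k
  omega

theorem lay_before {k i : ℕ} (h1 : N k < i) (h2 : i < sa k) : Lay i :=
  (lay_iff h1 (by have := consts k; omega)).2 (Or.inl h2)

theorem lay_between {k i : ℕ} (h1 : M k < i) (h2 : i < sb k + ss k) : Lay i :=
  (lay_iff (k := k) (by have := consts k; omega) (by have := consts k; omega)).2 (Or.inr ⟨h1, h2⟩)

theorem lay_after {k i : ℕ} (h1 : N k < i) (h2 : i ≤ 4 * N k + 3) : Lay i :=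
  lay_before h1 (by have := consts k; omega)

theorem Fan.le {σ p q : ℕ} (h : Fan σ p q) : p ≤ q := by
  cases h with
  | a k => omega
  | b k => have := consts k; omega

theorem Fan.lt {σ p q : ℕ} (h : Fan σ p q) : q + 2 < σ := by
  cases h with
  | a k => have := consts k; omega
  | b k => have := consts k; omega

theorem Fan.lay_start {σ p q : ℕ} (h : Fan σ p q) : p = 0 ∨ Lay p := by
  cases h with
  | a k => exact Or.inl rfl
  | b k => have := consts k; exact Or.inr (lay_before (k := k) (by omega) (by omega))

theorem Fan.lay_gap_src {σ p q r : ℕ} (h : Fan σ p q) (h1 : 1 ≤ r) (h2 : r ≤ q + 1) :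
    Lay (q + r) := by
  cases h with
  | a k => exact (lay_after (k := src k) (by omega) (by omega))
  | b k => have := consts k; exact (lay_between (k := k) (by omega) (by omega))

theorem Fan.lay_gap {σ p q r : ℕ} (h : Fan σ p q) (h1 : 1 ≤ r) (h2 : r ≤ q + 1) :
    Lay (σ + (q - p) + r) := by
  cases h with
  | a k => have := consts k; exact (lay_between (k := k) (by omega) (by omega))
  | b k => have := consts k; exact (lay_after (k := k + 1) (by omega) (by omega))

theorem Fan.not_lay {σ p q j : ℕ} (h : Fan σ p q) (hj : j ≤ q - p) : ¬ Lay (σ + j) := by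
  cases h with
  | a k => have := consts k; rw [lay_iff (k := k)] <;> omega
  | b k => have := consts k; rw [lay_iff (k := k)] <;> omega

theorem Fan.lt_start {σ p q j i : ℕ} (h : Fan σ p q) (hj : j ≤ q - p) (hi : Lay i)
    (hij : i < σ + j) : i < σ := by
  by_contra hc
  obtain ⟨m, rfl⟩ : ∃ m, i = σ + m := ⟨i - σ, by omega⟩
  exact h.not_lay (j := m) (by omega) hi

theorem lay_or_fan {i : ℕ} (hi : 1 ≤ i) :
    Lay i ∨ ∃ σ p q j, Fan σ p q ∧ j ≤ q - p ∧ i = σ + j := by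
  by_cases h : Lay i
  · exact Or.inl h
  right
  obtain ⟨h1, h2⟩ := stp_spec hi
  set k := stp i
  rw [lay_iff h1 h2] at h
  have := consts k
  by_cases h3 : i ≤ M k
  · exact ⟨_, _, _, i - sa k, Fan.a k, by omega, by omega⟩
  · exact ⟨_, _, _, i - (sb k + ss k), Fan.b k, by omega, by omega⟩

theorem exists_D (k : ℕ) (δ : ℝ) (hδ : 0 < δ) :
    ∃ D : ℝ, 0 ≤ D ∧ ∀ c : ℕ → ℝ, (∀ j ≤ M k, |c j| ≤ 2 / δ) →
      (∃ j ≤ N k + 1, (1 / 2 : ℝ) ^ (N k + 2) ≤ |c j|) →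
      ∃ q : ℕ → ℝ, ∑ i ∈ Finset.range (M k + 1), |q i| ≤ D ∧
        ∑ m ∈ Finset.range (M k + 1), |conv (M k) q c m - if m = N k + 1 then 1 else 0|
          ≤ δ / (k + 1) :=
  exists_bounded_quasi_inverse (M k) (N k + 1) (by have := consts k; omega) _ _ _
    (by positivity) (by positivity)

open Classical in
/-- The bound for the polynomials used at step `k`. -/
def Dk (k : ℕ) (δ : ℝ) : ℝ := if h : 0 < δ then (exists_D k δ h).choose else 0

theorem Dk_nonneg (k : ℕ) (δ : ℝ) : 0 ≤ Dk k δ := by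
  unfold Dk
  split_ifs with h
  · exact (exists_D k δ h).choose_spec.1
  · exact le_rfl

theorem Dk_spec (k : ℕ) {δ : ℝ} (h : 0 < δ) (c : ℕ → ℝ) (h1 : ∀ j ≤ M k, |c j| ≤ 2 / δ)
    (h2 : ∃ j ≤ N k + 1, (1 / 2 : ℝ) ^ (N k + 2) ≤ |c j|) :
    ∃ q : ℕ → ℝ, ∑ i ∈ Finset.range (M k + 1), |q i| ≤ Dk k δ ∧
        ∑ m ∈ Finset.range (M k + 1), |conv (M k) q c m - if m = N k + 1 then 1 else 0|
          ≤ δ / (k + 1) := by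
  rw [Dk, dif_pos h]
  exact (exists_D k δ h).choose_spec.2 c h1 h2

/-- The (rapidly decreasing) function governing the weights. -/
def Phi (i : ℕ) (δ : ℝ) : ℝ :=
  (δ / (i + 2)) ^ (4 * i + 16) / (1 + ∑ k ∈ Finset.range (i + 1), Dk k δ)

theorem Phi_den_pos (i : ℕ) (δ : ℝ) : 1 ≤ 1 + ∑ k ∈ Finset.range (i + 1), Dk k δ :=
  le_add_of_nonneg_right (Finset.sum_nonneg fun k _ => Dk_nonneg k δ)

theorem Phi_pos (i : ℕ) {δ : ℝ} (h : 0 < δ) : 0 < Phi i δ := by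
  have := Phi_den_pos i δ
  unfold Phi
  positivity

theorem div_le_one_aux (i : ℕ) {δ : ℝ} (h1 : δ ≤ 1) : δ / (i + 2) ≤ 1 := by
  rw [div_le_one (by positivity)]
  have : (0 : ℝ) ≤ i := by positivity
  linarith

theorem Phi_le_pow (i : ℕ) {δ : ℝ} (h : 0 < δ) (h1 : δ ≤ 1) {n : ℕ} (hn : n ≤ 4 * i + 16) :
    Phi i δ ≤ (δ / (i + 2)) ^ n := by
  have h2 := Phi_den_pos i δ
  have h3 := div_le_one_aux i h1
  calc Phi i δ ≤ (δ / (i + 2)) ^ (4 * i + 16) := div_le_self (by positivity) h2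
    _ ≤ _ := pow_le_pow_of_le_one (by positivity) h3 hn

theorem Phi_mul_le_pow {i k : ℕ} {δ : ℝ} (h : 0 < δ) (h1 : δ ≤ 1) {n : ℕ} (hn : n ≤ 4 * i + 16)
    (hk : k ≤ i) : Dk k δ * Phi i δ ≤ (δ / (i + 2)) ^ n := by
  have h2 := Phi_den_pos i δ
  have h3 := div_le_one_aux i h1
  have h4 : Dk k δ ≤ 1 + ∑ k ∈ Finset.range (i + 1), Dk k δ := by
    have := Finset.single_le_sum (f := fun k => Dk k δ) (fun k _ => Dk_nonneg k δ)
      (Finset.mem_range.2 (Nat.lt_succ_of_le hk))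
    linarith
  calc Dk k δ * Phi i δ ≤ (1 + ∑ k ∈ Finset.range (i + 1), Dk k δ) * Phi i δ :=
        mul_le_mul_of_nonneg_right h4 (Phi_pos i h).le
    _ = (δ / (i + 2)) ^ (4 * i + 16) := by
        unfold Phi
        field_simp
    _ ≤ _ := pow_le_pow_of_le_one (by positivity) h3 hn

theorem Phi_le_half_pow (i : ℕ) {δ : ℝ} (h : 0 < δ) (h1 : δ ≤ 1) {n : ℕ} (hn : n ≤ 4 * i + 16)
    (hn0 : 1 ≤ n) : Phi i δ ≤ δ ^ n / 2 := by
  refine (Phi_le_pow i h h1 hn).trans ?_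
  rw [div_pow]
  refine div_le_div_of_nonneg_left (by positivity) (by norm_num) ?_
  have : (0 : ℝ) ≤ i := by positivity
  calc (2 : ℝ) ≤ i + 2 := by linarith
    _ = (i + 2) ^ 1 := (pow_one _).symm
    _ ≤ (i + 2) ^ n := pow_le_pow_right₀ (by linarith) hn0

theorem Phi_le_half (i : ℕ) {δ : ℝ} (h : 0 < δ) (h1 : δ ≤ 1) : Phi i δ ≤ δ / 2 := by
  simpa using Phi_le_half_pow i h h1 (n := 1) (by omega) le_rfl

theorem Phi_le_inv (i : ℕ) {δ : ℝ} (h : 0 < δ) (h1 : δ ≤ 1) : Phi i δ ≤ 1 / (i + 2) := by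
  refine (Phi_le_pow i h h1 (n := 1) (by omega)).trans ?_
  rw [pow_one]
  exact div_le_div_of_nonneg_right h1 (by positivity)

/-- First index of the fan containing `i`. -/
def start (i : ℕ) : ℕ := if i ≤ M (stp i) then sa (stp i) else sb (stp i) + ss (stp i)
/-- Last index of the block copied by the fan containing `i`. -/
def qend (i : ℕ) : ℕ := if i ≤ M (stp i) then N (src (stp i)) else M (stp i)
/-- The index copied at `i`. -/
def rho (i : ℕ) : ℕ := if i ≤ M (stp i) then i - sa (stp i) else i - sb (stp i)

theorem Fan.data {σ p q j : ℕ} (h : Fan σ p q) (hj : j ≤ q - p) :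
    IsFan (σ + j) ∧ start (σ + j) = σ ∧ qend (σ + j) = q ∧ rho (σ + j) = p + j := by
  cases h with
  | a k =>
    have := consts k
    have h1 : N k < sa k + j := by omega
    have h2 : sa k + j ≤ N (k + 1) := by omega
    rw [isFan_iff h1 h2, start, qend, rho, stp_eq h1 h2]
    refine ⟨by omega, ?_, ?_, ?_⟩ <;> rw [if_pos (by omega)]
    omega
  | b k =>
    have := consts k
    have h1 : N k < sb k + ss k + j := by omega
    have h2 : sb k + ss k + j ≤ N (k + 1) := by omega
    rw [isFan_iff h1 h2, start, qend, rho, stp_eq h1 h2]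
    refine ⟨by omega, ?_, ?_, ?_⟩ <;> rw [if_neg (by omega)]
    omega

open Classical in
/-- The weights. -/
def w : ℕ → ℝ
  | 0 => 1
  | i + 1 =>
    if IsFan (i + 1) then
      (if i + 1 = start (i + 1) then Phi (i + 1) (w i) else w i) *
        Phi (qend (i + 1) + 1) (w (min (qend (i + 1)) i))
    else Phi (i + 1) (Phi (i + 1) (w i))
decreasing_by all_goals omega

/-- The intermediate weights. -/
def U (i : ℕ) : ℝ := Phi i (w (i - 1))

theorem w_zero : w 0 = 1 := by rw [w]

theorem w_lay {i : ℕ} (h : Lay i) : w i = Phi i (U i) := by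
  obtain ⟨h1, h2⟩ := h
  obtain ⟨m, rfl⟩ : ∃ m, i = m + 1 := ⟨i - 1, by omega⟩
  rw [w, if_neg h2, U]
  rfl

theorem w_fan {σ p q : ℕ} (h : Fan σ p q) : ∀ j ≤ q - p, w (σ + j) = U σ * U (q + 1) ^ (j + 1) := by
  intro j
  have hlt := h.lt
  induction j with
  | zero =>
    intro hj
    obtain ⟨h1, h2, h3, -⟩ := h.data hj
    obtain ⟨m, rfl⟩ : ∃ m, σ = m + 1 := ⟨σ - 1, by omega⟩
    simp only [add_zero] at *
    rw [w, if_pos h1, if_pos h2.symm, h3, min_eq_left (by omega), U, U]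
    simp
  | succ j ih =>
    intro hj
    obtain ⟨h1, h2, h3, -⟩ := h.data hj
    have e : σ + (j + 1) = (σ + j) + 1 := by ring
    rw [e] at h1 h2 h3 ⊢
    rw [w, if_pos h1, if_neg (by omega), h3, min_eq_left (by omega), ih (by omega)]
    simp only [U, Nat.add_sub_cancel]
    ring

theorem w_pos_le (i : ℕ) : 0 < w i ∧ w i ≤ 1 := by
  induction i using Nat.strong_induction_on with
  | _ i ih =>
    rcases Nat.eq_zero_or_pos i with rfl | hi
    · rw [w_zero]; norm_num
    have hU : ∀ j, 1 ≤ j → j ≤ i → 0 < U j ∧ U j ≤ 1 := by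
      intro j h1 h2
      obtain ⟨h3, h4⟩ := ih (j - 1) (by omega)
      exact ⟨Phi_pos _ h3, (Phi_le_half _ h3 h4).trans (by linarith)⟩
    rcases lay_or_fan hi with h | ⟨σ, p, q, j, h, hj, rfl⟩
    · rw [w_lay h]
      obtain ⟨h1, h2⟩ := hU i hi le_rfl
      exact ⟨Phi_pos _ h1, (Phi_le_half _ h1 h2).trans (by linarith)⟩
    · have hlt := h.lt
      obtain ⟨h1, h2⟩ := hU σ (by omega) (by omega)
      obtain ⟨h3, h4⟩ := hU (q + 1) (by omega) (by omega)
      rw [w_fan h j hj]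
      exact ⟨by positivity, mul_le_one₀ h2 (by positivity) (pow_le_one₀ h3.le h4)⟩

theorem w_pos (i : ℕ) : 0 < w i := (w_pos_le i).1
theorem w_le_one (i : ℕ) : w i ≤ 1 := (w_pos_le i).2
theorem U_pos (i : ℕ) : 0 < U i := Phi_pos _ (w_pos _)
theorem U_le_half (i : ℕ) : U i ≤ w (i - 1) / 2 := Phi_le_half _ (w_pos _) (w_le_one _)
theorem U_le_half_sq (i : ℕ) : U i ≤ w (i - 1) ^ 2 / 2 :=
  Phi_le_half_pow _ (w_pos _) (w_le_one _) (by omega) (by omega)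
theorem U_le_one (i : ℕ) : U i ≤ 1 := by
  have := U_le_half i; have := w_le_one (i - 1); linarith
theorem U_succ_le_half (i : ℕ) : U (i + 1) ≤ w i / 2 := U_le_half (i + 1)
theorem U_succ_le (i : ℕ) : U (i + 1) ≤ w i := by
  have := U_succ_le_half i; have := w_pos i; linarith
theorem U_le_inv (i : ℕ) : U i ≤ 1 / (i + 2) := Phi_le_inv _ (w_pos _) (w_le_one _)

theorem w_lay_le_pow {i : ℕ} (h : Lay i) {n : ℕ} (hn : n ≤ 4 * i + 16) (h1 : 1 ≤ n) :
    w i ≤ U i ^ n / 2 := by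
  rw [w_lay h]
  exact Phi_le_half_pow _ (U_pos i) (U_le_one i) hn h1

theorem w_lay_le {i : ℕ} (h : Lay i) : w i ≤ U i / 2 := by
  simpa using w_lay_le_pow h (n := 1) (by omega) le_rfl

theorem w_succ_le (i : ℕ) : w (i + 1) ≤ w i := by
  have hu := U_succ_le i
  rcases lay_or_fan (i := i + 1) (by omega) with h | ⟨σ, p, q, j, h, hj, e⟩
  · have h1 := w_lay_le h
    have := U_pos (i + 1)
    linarith
  · rw [e, w_fan h j hj]
    have h3 := U_pos (q + 1)
    have h4 := U_le_one (q + 1)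
    have h5 := U_pos σ
    rcases Nat.eq_zero_or_pos j with rfl | hj0
    · have : σ = i + 1 := by omega
      subst this
      calc U (i + 1) * U (q + 1) ^ (0 + 1) ≤ U (i + 1) :=
            mul_le_of_le_one_right h5.le (pow_le_one₀ h3.le h4)
        _ ≤ w i := hu
    · have : i = σ + (j - 1) := by omega
      rw [this, w_fan h _ (by omega)]
      exact mul_le_mul_of_nonneg_left (pow_le_pow_of_le_one h3.le h4 (by omega)) h5.le

theorem w_anti : Antitone w := antitone_nat_of_succ_le w_succ_le

theorem U_anti_lay {i j : ℕ} (h : Lay i) (hij : i ≤ j) : U j ≤ U i := by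
  rcases hij.eq_or_lt with rfl | hlt
  · exact le_rfl
  · have h1 := U_le_half j
    have h2 := w_anti (show i ≤ j - 1 by omega)
    have h3 := w_lay_le h
    have := U_pos i
    linarith

/-- For `i < j`, the weight `U j` is below `w i`. -/
theorem U_le_w {i j : ℕ} (h : i < j) : U j ≤ w i ^ 2 / 2 := by
  refine (U_le_half_sq j).trans ?_
  have := w_anti (show i ≤ j - 1 by omega)
  have := w_pos (j - 1)
  gcongr

open Classical in
/-- The coefficients of the copied vectors. -/
def cc (i : ℕ) : ℝ := if IsFan i then U (start i) else 0

theorem not_isFan_zero : ¬ IsFan 0 := by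
  have h : stp 0 = 0 := by simp [stp]
  rw [IsFan, h, sa, sb]
  omega

theorem cc_zero : cc 0 = 0 := by
  rw [cc, if_neg not_isFan_zero]

theorem cc_lay {i : ℕ} (h : Lay i) : cc i = 0 := by rw [cc, if_neg h.2]

theorem cc_fan {σ p q j : ℕ} (h : Fan σ p q) (hj : j ≤ q - p) : cc (σ + j) = U σ := by
  obtain ⟨h1, h2, -, -⟩ := h.data hj
  rw [cc, if_pos h1, h2]

theorem rho_fan {σ p q j : ℕ} (h : Fan σ p q) (hj : j ≤ q - p) : rho (σ + j) = p + j :=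
  (h.data hj).2.2.2

theorem cc_nonneg (i : ℕ) : 0 ≤ cc i := by
  rw [cc]; split_ifs
  · exact (U_pos _).le
  · exact le_rfl

/-- The vectors forming the orbit of `T`. -/
def ev : ℕ → L1
  | 0 => fv 0
  | i + 1 => w (i + 1) • fv (i + 1) + cc (i + 1) • ev (min (rho (i + 1)) i)
decreasing_by omega

theorem ev_zero : ev 0 = fv 0 := by rw [ev]

theorem ev_lay {i : ℕ} (h : Lay i) : ev i = w i • fv i := by
  obtain ⟨m, rfl⟩ : ∃ m, i = m + 1 := ⟨i - 1, by have := h.1; omega⟩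
  rw [ev, cc_lay h, zero_smul, add_zero]

theorem ev_fan {σ p q j : ℕ} (h : Fan σ p q) (hj : j ≤ q - p) :
    ev (σ + j) = w (σ + j) • fv (σ + j) + U σ • ev (p + j) := by
  obtain ⟨m, hm⟩ : ∃ m, σ + j = m + 1 := ⟨σ + j - 1, by have := h.lt; omega⟩
  have h1 := cc_fan h hj
  have h2 := rho_fan h hj
  rw [hm] at h1 h2 ⊢
  rw [ev, h1, h2, min_eq_left (by have := h.lt; have := h.le; omega)]

theorem norm_ev_le_one (i : ℕ) : ‖ev i‖ ≤ 1 := by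
  induction i using Nat.strong_induction_on with
  | _ i ih =>
    rcases Nat.eq_zero_or_pos i with rfl | hi
    · rw [ev_zero, norm_fv]
    have hw := w_pos i
    rcases lay_or_fan hi with h | ⟨σ, p, q, j, h, hj, rfl⟩
    · rw [ev_lay h, norm_smul, norm_fv, mul_one, Real.norm_of_nonneg hw.le]
      exact w_le_one i
    · have hlt := h.lt
      rw [ev_fan h hj]
      refine (norm_add_le _ _).trans ?_
      rw [norm_smul, norm_smul, norm_fv, mul_one, Real.norm_of_nonneg hw.le,
        Real.norm_of_nonneg (U_pos σ).le]
      have h1 : w (σ + j) ≤ 1 / 2 := by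
        have h2 : w (σ + j) ≤ U σ := by
          rw [w_fan h j hj]
          exact mul_le_of_le_one_right (U_pos σ).le (pow_le_one₀ (U_pos _).le (U_le_one _))
        have := U_le_half σ
        have := w_le_one (σ - 1)
        linarith
      have h3 : U σ * ‖ev (p + j)‖ ≤ 1 / 2 := by
        have h4 := ih (p + j) (by have := h.le; omega)
        have := U_le_half σ
        have := w_le_one (σ - 1)
        calc U σ * ‖ev (p + j)‖ ≤ U σ * 1 := mul_le_mul_of_nonneg_left h4 (U_pos σ).le
          _ ≤ 1 / 2 := by linarith
      linarith

theorem w_fan_le {σ p q j : ℕ} (h : Fan σ p q) (hj : j ≤ q - p) : w (σ + j) ≤ U σ := by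
  rw [w_fan h j hj]
  exact mul_le_of_le_one_right (U_pos σ).le (pow_le_one₀ (U_pos _).le (U_le_one _))

/-- After a layer index the vectors are small. -/
theorem norm_ev_le_of_lay {i i' : ℕ} (hi : Lay i) (h : i < i') : ‖ev i'‖ ≤ w i ^ 2 := by
  have hw := w_pos i'
  rcases lay_or_fan (i := i') (by omega) with h' | ⟨σ, p, q, j, h', hj, rfl⟩
  · rw [ev_lay h', norm_smul, norm_fv, mul_one, Real.norm_of_nonneg hw.le]
    have h1 := w_lay_le h'
    have h2 := U_le_w h
    have := U_pos i'
    nlinarith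
  · have hσ := h'.lt_start hj hi h
    rw [ev_fan h' hj]
    refine (norm_add_le _ _).trans ?_
    rw [norm_smul, norm_smul, norm_fv, mul_one, Real.norm_of_nonneg hw.le,
      Real.norm_of_nonneg (U_pos σ).le]
    have h1 := w_fan_le h' hj
    have h2 := U_le_w hσ
    have h3 : U σ * ‖ev (p + j)‖ ≤ U σ :=
      mul_le_of_le_one_right (U_pos σ).le (norm_ev_le_one _)
    linarith

/-- The columns of the operator. -/
def Tu (i : ℕ) : L1 := (w i)⁻¹ • (ev (i + 1) - cc i • ev (rho i + 1))

theorem ev_start {σ p q : ℕ} (h : Fan σ p q) : ev p = w p • fv p := by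
  rcases h.lay_start with rfl | h
  · rw [ev_zero, w_zero, one_smul]
  · exact ev_lay h

theorem Tu_cases (i : ℕ) :
    (cc i = 0 ∧ Lay (i + 1) ∧ Tu i = (w (i + 1) / w i) • fv (i + 1)) ∨
    (cc i = 0 ∧ ∃ p q, Fan (i + 1) p q ∧
      Tu i = (w (i + 1) / w i) • fv (i + 1) + (U (i + 1) * w p / w i) • fv p) ∨
    (∃ σ p q j, Fan σ p q ∧ j < q - p ∧ i = σ + j ∧ Tu i = U (q + 1) • fv (i + 1)) ∨
    (∃ σ p q, Fan σ p q ∧ i = σ + (q - p) ∧ Lay (i + 1) ∧ Lay (q + 1) ∧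
      Tu i = (w (i + 1) / w i) • fv (i + 1) - (U σ * w (q + 1) / w i) • fv (q + 1)) := by
  have hw := (w_pos i).ne'
  by_cases h0 : i = 0 ∨ Lay i
  · have hc : cc i = 0 := by
      rcases h0 with rfl | h0
      · exact cc_zero
      · exact cc_lay h0
    have hT : Tu i = (w i)⁻¹ • ev (i + 1) := by rw [Tu, hc, zero_smul, sub_zero]
    rcases lay_or_fan (i := i + 1) (by omega) with h | ⟨σ, p, q, j, h, hj, e⟩
    · left
      refine ⟨hc, h, ?_⟩
      rw [hT, ev_lay h, smul_smul]
      congr 1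
      field_simp
    · right; left
      have hlt := h.lt
      have hj0 : j = 0 := by
        rcases h0 with rfl | h0
        · omega
        · by_contra hj0
          refine h.not_lay (j := j - 1) (by omega) ?_
          have : σ + (j - 1) = i := by omega
          rwa [this]
      subst hj0
      have e' : σ = i + 1 := by omega
      subst e'
      refine ⟨hc, p, q, h, ?_⟩
      have h2 := ev_fan h hj
      simp only [add_zero] at h2
      rw [hT, h2, ev_start h, smul_add, smul_smul, smul_smul, smul_smul]
      congr 2 <;> field_simp
  · push Not at h0
    rcases lay_or_fan (i := i) (by omega) with h | ⟨σ, p, q, j, h, hj, rfl⟩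
    · exact absurd h h0.2
    right; right
    have hT : Tu (σ + j) = (w (σ + j))⁻¹ • (ev (σ + j + 1) - U σ • ev (p + j + 1)) := by
      rw [Tu, cc_fan h hj, rho_fan h hj]
    have hle := h.le
    rcases hj.lt_or_eq with hj' | hj'
    · left
      refine ⟨σ, p, q, j, h, hj', rfl, ?_⟩
      have e1 : ev (σ + j + 1) = _ := ev_fan h (j := j + 1) hj'
      rw [hT, e1, add_assoc p j 1, add_sub_cancel_right, smul_smul]
      congr 1
      rw [w_fan h _ hj', w_fan h _ hj]
      have := (U_pos σ).ne'
      have := (U_pos (q + 1)).ne'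
      field_simp
      exact pow_succ _ _
    · right
      have hl1 := h.lay_gap (r := 1) le_rfl (by omega)
      have hl2 := h.lay_gap_src (r := 1) le_rfl (by omega)
      refine ⟨σ, p, q, h, by omega, by rwa [hj'], hl2, ?_⟩
      have e : p + j + 1 = q + 1 := by omega
      rw [hT, e, ev_lay hl2, hj', ev_lay hl1, smul_sub, smul_smul, smul_smul, smul_smul]
      congr 2 <;> field_simp

theorem ratio_lay {i : ℕ} (h : Lay (i + 1)) : 0 ≤ w (i + 1) / w i ∧ w (i + 1) / w i ≤ w i / 2 := by
  have h1 := w_pos i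
  have h2 := w_pos (i + 1)
  refine ⟨by positivity, ?_⟩
  rw [div_le_iff₀ h1]
  have h3 := w_lay_le h
  have h4 := U_le_w (Nat.lt_succ_self i)
  have h5 := U_pos (i + 1)
  simp only [Nat.succ_eq_add_one] at h4
  nlinarith

theorem ratio_start {i p q : ℕ} (h : Fan (i + 1) p q) :
    (0 ≤ w (i + 1) / w i ∧ w (i + 1) / w i ≤ w i / 2) ∧
    (0 ≤ U (i + 1) * w p / w i ∧ U (i + 1) * w p / w i ≤ w i / 2) := by
  have h1 := w_pos i
  have h2 := w_pos (i + 1)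
  have h3 := U_pos (i + 1)
  have h6 := w_pos p
  have h4 := U_le_w (Nat.lt_succ_self i)
  simp only [Nat.succ_eq_add_one] at h4
  have h5 : w (i + 1) ≤ U (i + 1) := w_fan_le h (Nat.zero_le _)
  have h7 : U (i + 1) * w p ≤ U (i + 1) := mul_le_of_le_one_right h3.le (w_le_one p)
  refine ⟨⟨by positivity, ?_⟩, by positivity, ?_⟩
  · rw [div_le_iff₀ h1]; nlinarith
  · rw [div_le_iff₀ h1]; nlinarith

theorem ratio_end {σ p q : ℕ} (h : Fan σ p q) :
    0 ≤ U σ * w (q + 1) / w (σ + (q - p)) ∧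
      U σ * w (q + 1) / w (σ + (q - p)) ≤ U (q + 1) / 2 := by
  have h1 := w_pos (σ + (q - p))
  have h2 := w_pos (q + 1)
  have h3 := U_pos σ
  have h4 := U_pos (q + 1)
  refine ⟨by positivity, ?_⟩
  rw [div_le_iff₀ h1, w_fan h _ le_rfl]
  have h5 := w_lay_le_pow (h.lay_gap_src (r := 1) le_rfl (by omega)) (n := q + 2)
    (by omega) (by omega)
  have h6 : U (q + 1) ^ (q + 2) ≤ U (q + 1) ^ (q - p + 1 + 1) :=
    pow_le_pow_of_le_one h4.le (U_le_one _) (by omega)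
  rw [pow_succ _ (q - p + 1)] at h6
  calc U σ * w (q + 1) ≤ U σ * (U (q + 1) ^ (q - p + 1) * U (q + 1) / 2) := by
        refine mul_le_mul_of_nonneg_left (by linarith) h3.le
    _ = _ := by ring

theorem Tu_form (i : ℕ) : ∃ α β : ℝ, ∃ r : ℕ, Tu i = α • fv (i + 1) + β • fv r ∧
    (r = 0 ∨ Lay r) ∧ |α| + |β| ≤ 1 := by
  have hw1 := w_le_one i
  have hw0 := w_pos i
  rcases Tu_cases i with ⟨-, h, e⟩ | ⟨-, p, q, h, e⟩ | ⟨σ, p, q, j, h, hj, rfl, e⟩ |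
    ⟨σ, p, q, h, rfl, h1, h2, e⟩
  · refine ⟨w (i + 1) / w i, 0, 0, by rw [e, zero_smul, add_zero], Or.inl rfl, ?_⟩
    obtain ⟨h3, h4⟩ := ratio_lay h
    rw [abs_of_nonneg h3, abs_zero]; linarith
  · refine ⟨_, _, p, e, h.lay_start, ?_⟩
    obtain ⟨⟨h3, h4⟩, h5, h6⟩ := ratio_start h
    rw [abs_of_nonneg h3, abs_of_nonneg h5]; linarith
  · refine ⟨U (q + 1), 0, 0, by rw [e, zero_smul, add_zero], Or.inl rfl, ?_⟩
    rw [abs_of_nonneg (U_pos _).le, abs_zero]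
    linarith [U_le_one (q + 1)]
  · refine ⟨w (σ + (q - p) + 1) / w (σ + (q - p)), -(U σ * w (q + 1) / w (σ + (q - p))), q + 1,
      by rw [e, neg_smul, sub_eq_add_neg], Or.inr h2, ?_⟩
    obtain ⟨h3, h4⟩ := ratio_lay h1
    obtain ⟨h5, h6⟩ := ratio_end h
    rw [abs_neg, abs_of_nonneg h3, abs_of_nonneg h5]
    linarith [U_le_one (q + 1)]

theorem norm_comb_le (α β : ℝ) (x y : L1) : ‖α • x + β • y‖ ≤ |α| * ‖x‖ + |β| * ‖y‖ := by
  refine (norm_add_le _ _).trans ?_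
  rw [norm_smul, norm_smul, Real.norm_eq_abs, Real.norm_eq_abs]

theorem norm_Tu_le (i : ℕ) : ‖Tu i‖ ≤ 1 := by
  obtain ⟨α, β, r, e, -, h⟩ := Tu_form i
  rw [e]
  refine (norm_comb_le _ _ _ _).trans ?_
  rw [norm_fv, norm_fv, mul_one, mul_one]
  exact h

/-- The operator. -/
def T : L1 →L[ℝ] L1 := lift Tu 1 norm_Tu_le

theorem T_fv (i : ℕ) : T (fv i) = Tu i := lift_fv _ _ _ _

theorem norm_T_le : ‖T‖ ≤ 1 := norm_clm_le T fun i => by rw [T_fv]; exact norm_Tu_le i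

theorem norm_T_apply_le (x : L1) : ‖T x‖ ≤ ‖x‖ := by
  have := T.le_of_opNorm_le norm_T_le x
  simpa using this

theorem norm_T_pow_apply_le (n : ℕ) (x : L1) : ‖(T ^ n) x‖ ≤ ‖x‖ := by
  induction n generalizing x with
  | zero => simp
  | succ n ih =>
    rw [pow_succ, mul_apply_eq_comp]
    exact (ih _).trans (norm_T_apply_le x)

theorem ev_eq (i : ℕ) : ev i = w i • fv i + cc i • ev (rho i) := by
  rcases Nat.eq_zero_or_pos i with rfl | hi
  · rw [ev_zero, cc_zero, w_zero, zero_smul, one_smul, add_zero]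
  rcases lay_or_fan hi with h | ⟨σ, p, q, j, h, hj, rfl⟩
  · rw [ev_lay h, cc_lay h, zero_smul, add_zero]
  · rw [ev_fan h hj, cc_fan h hj, rho_fan h hj]

theorem T_ev (i : ℕ) : T (ev i) = ev (i + 1) := by
  induction i using Nat.strong_induction_on with
  | _ i ih =>
    have hw := (w_pos i).ne'
    have key : cc i • T (ev (rho i)) = cc i • ev (rho i + 1) := by
      rcases Nat.eq_zero_or_pos i with rfl | hi
      · rw [cc_zero, zero_smul, zero_smul]
      rcases lay_or_fan hi with h | ⟨σ, p, q, j, h, hj, rfl⟩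
      · rw [cc_lay h, zero_smul, zero_smul]
      · rw [rho_fan h hj, ih (p + j) (by have := h.lt; have := h.le; omega)]
    rw [ev_eq i, map_add, map_smul, map_smul, T_fv, key, Tu, smul_smul, mul_inv_cancel₀ hw,
      one_smul, sub_add_cancel]

theorem T_pow_ev (n i : ℕ) : (T ^ n) (ev i) = ev (i + n) := by
  induction n generalizing i with
  | zero => simp
  | succ n ih =>
    rw [pow_succ, mul_apply_eq_comp, T_ev, ih]
    congr 1; omega

theorem fv_eq (i : ℕ) : fv i = (w i)⁻¹ • (ev i - cc i • ev (rho i)) := by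
  have hw := (w_pos i).ne'
  rw [eq_inv_smul_iff₀ hw, eq_sub_iff_add_eq, ← ev_eq]

theorem T_pow_fv (n i : ℕ) : (T ^ n) (fv i) = (w i)⁻¹ • (ev (i + n) - cc i • ev (rho i + n)) := by
  conv_lhs => rw [fv_eq]
  rw [map_smul, map_sub, map_smul, T_pow_ev, T_pow_ev]

/-! ### The negative part -/

theorem Tu_neg (i : ℕ) : ∃ b : ℝ, ∃ r : ℕ, 0 ≤ b ∧ b ≤ 1 / (r + 1) ∧
    ∀ j, max (-(Tu i j)) 0 = b * fv r j := by
  have hw := w_pos i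
  have hw1 := w_pos (i + 1)
  have nn : ∀ r j, 0 ≤ fv r j := fun r j => by rw [fv_apply]; split_ifs <;> norm_num
  have pos : (∀ j, 0 ≤ Tu i j) → ∃ b : ℝ, ∃ r : ℕ, 0 ≤ b ∧ b ≤ 1 / (r + 1) ∧
      ∀ j, max (-(Tu i j)) 0 = b * fv r j := by
    intro h
    refine ⟨0, 0, le_rfl, by norm_num, fun j => ?_⟩
    rw [zero_mul, max_eq_right]
    linarith [h j]
  rcases Tu_cases i with ⟨-, h, e⟩ | ⟨-, p, q, h, e⟩ | ⟨σ, p, q, j, h, hj, -, e⟩ |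
    ⟨σ, p, q, h, rfl, h1, h2, e⟩
  · refine pos fun j => ?_
    rw [e]
    simp only [lp.coeFn_smul, Pi.smul_apply, smul_eq_mul]
    exact mul_nonneg (ratio_lay h).1 (nn _ _)
  · refine pos fun j => ?_
    rw [e]
    simp only [lp.coeFn_smul, lp.coeFn_add, Pi.add_apply, Pi.smul_apply, smul_eq_mul]
    exact add_nonneg (mul_nonneg (ratio_start h).1.1 (nn _ _))
      (mul_nonneg (ratio_start h).2.1 (nn _ _))
  · refine pos fun j => ?_
    rw [e]
    simp only [lp.coeFn_smul, Pi.smul_apply, smul_eq_mul]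
    exact mul_nonneg (U_pos _).le (nn _ _)
  · obtain ⟨h3, h4⟩ := ratio_end h
    obtain ⟨h5, h6⟩ := ratio_lay h1
    refine ⟨_, q + 1, h3, ?_, fun j => ?_⟩
    · have h7 := U_le_inv (q + 1)
      have h8 := U_pos (q + 1)
      have h9 : (1 : ℝ) / ((q + 1 : ℕ) + 2) ≤ 1 / ((q + 1 : ℕ) + 1) :=
        one_div_le_one_div_of_le (by positivity) (by linarith)
      linarith
    · rw [e]
      simp only [lp.coeFn_smul, lp.coeFn_sub, Pi.sub_apply, Pi.smul_apply, smul_eq_mul, fv_apply]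
      have hlt := h.lt
      by_cases hj : j = q + 1
      · rw [if_neg (by omega), if_pos hj]
        simp only [mul_zero, mul_one, zero_sub, neg_neg]
        exact max_eq_left h3
      · rw [if_neg hj]
        simp only [mul_zero, sub_zero]
        refine max_eq_right ?_
        split_ifs <;> simp [h5]

theorem exists_compact_neg : ∃ S : L1 →L[ℝ] L1,
    (∀ i j : ℕ, S (lp.single 1 j 1) i = max (-(T (lp.single 1 j 1) i)) 0) ∧
      IsCompactOperator S := by
  choose b r hb0 hb1 hb using Tu_neg
  have hle : ∀ i, ‖b i • fv (r i)‖ ≤ 1 := fun i => by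
    rw [norm_smul, norm_fv, mul_one, Real.norm_of_nonneg (hb0 i)]
    refine (hb1 i).trans ?_
    rw [div_le_one (by positivity)]
    have : (0 : ℝ) ≤ r i := by positivity
    linarith
  let S : L1 →L[ℝ] L1 := lift (fun i => b i • fv (r i)) 1 hle
  have hS : ∀ i, S (fv i) = b i • fv (r i) := fun i => lift_fv _ _ _ _
  let P : ℕ → L1 →L[ℝ] L1 := fun n =>
    ∑ i ∈ Finset.range n, (coord i).smulRight (fv i)
  have hPc : ∀ n, IsCompactOperator (P n) := by
    intro n
    induction n with
    | zero => simpa [P] using (isCompactOperator_zero : IsCompactOperator (0 : L1 → L1))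
    | succ n ih =>
      have : P (n + 1) = P n + (coord n).smulRight (fv n) := Finset.sum_range_succ _ _
      rw [this]
      refine IsCompactOperator.add ih ?_
      have h1 : IsCompactOperator (coord n) :=
        isCompactOperator_of_locallyCompactSpace_dom (coord n)
      exact h1.clm_comp (ContinuousLinearMap.toSpanSingleton ℝ (fv n))
  have hP : ∀ n i, P n (fv i) = if i < n then fv i else 0 := by
    intro n i
    simp only [P, sum_apply, ContinuousLinearMap.smulRight_apply, coord_fv,
      ite_smul, one_smul, zero_smul, Finset.sum_ite_eq', Finset.mem_range]
  refine ⟨S, fun i j => ?_, ?_⟩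
  · change S (fv j) i = max (-(T (fv j) i)) 0
    rw [hS, T_fv, hb]
    simp
  · have hlim : Tendsto (fun n => (P n).comp S) atTop (𝓝 S) := by
      rw [tendsto_iff_norm_sub_tendsto_zero]
      refine squeeze_zero (fun _ => norm_nonneg _) (fun n => ?_)
        (tendsto_one_div_add_atTop_nhds_zero_nat (𝕜 := ℝ))
      refine norm_clm_le _ fun i => ?_
      rw [sub_apply, ContinuousLinearMap.comp_apply, hS, map_smul, hP]
      split_ifs with h
      · rw [sub_self, norm_zero]; positivity
      · rw [smul_zero, zero_sub, norm_neg, norm_smul, norm_fv, mul_one,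
          Real.norm_of_nonneg (hb0 i)]
        refine (hb1 i).trans (one_div_le_one_div_of_le (by positivity) ?_)
        have : (n : ℝ) ≤ r i := by exact_mod_cast not_lt.1 h
        linarith
    exact isCompactOperator_of_tendsto hlim (Eventually.of_forall fun n => (hPc n).comp_clm S)

theorem cc_le_one (i : ℕ) : cc i ≤ 1 := by
  rw [cc]; split_ifs
  · exact U_le_one _
  · norm_num

theorem rho_le (i : ℕ) : rho i ≤ i := by
  rw [rho]; split_ifs <;> omega

/-- Indices `i > L` in a fan copying a block contained in `[0, L)`. -/
def Special (L i : ℕ) : Prop := ∃ σ p q j, Fan σ p q ∧ q < L ∧ j ≤ q - p ∧ i = σ + j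

theorem Special.not_lay {L i : ℕ} (h : Special L i) : ¬ Lay i := by
  obtain ⟨σ, p, q, j, h, -, hj, rfl⟩ := h
  exact h.not_lay hj

theorem Tu_of_not_special {L i : ℕ} (hL : Lay (L + 1)) (hi : L < i) (hs : ¬ Special L i) :
    ∃ α β : ℝ, ∃ r : ℕ, Tu i = α • fv (i + 1) + β • fv r ∧
    (r = 0 ∨ Lay r) ∧ |α| + |β| ≤ 2 * U (L + 1) := by
  have hw0 := w_pos i
  have hV := U_pos (L + 1)
  have hwV : w i ≤ U (L + 1) / 2 := (w_anti hi).trans (w_lay_le hL)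
  rcases Tu_cases i with ⟨-, h, e⟩ | ⟨-, p, q, h, e⟩ | ⟨σ, p, q, j, h, hj, rfl, e⟩ |
    ⟨σ, p, q, h, rfl, h1, h2, e⟩
  · refine ⟨w (i + 1) / w i, 0, 0, by rw [e, zero_smul, add_zero], Or.inl rfl, ?_⟩
    obtain ⟨h3, h4⟩ := ratio_lay h
    rw [abs_of_nonneg h3, abs_zero]; linarith
  · refine ⟨_, _, p, e, h.lay_start, ?_⟩
    obtain ⟨⟨h3, h4⟩, h5, h6⟩ := ratio_start h
    rw [abs_of_nonneg h3, abs_of_nonneg h5]; linarith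
  · refine ⟨U (q + 1), 0, 0, by rw [e, zero_smul, add_zero], Or.inl rfl, ?_⟩
    rw [abs_of_nonneg (U_pos _).le, abs_zero]
    have hq : L ≤ q := by
      by_contra hc
      exact hs ⟨σ, p, q, j, h, by omega, by omega, rfl⟩
    have := U_anti_lay hL (show L + 1 ≤ q + 1 by omega)
    linarith
  · refine ⟨w (σ + (q - p) + 1) / w (σ + (q - p)), -(U σ * w (q + 1) / w (σ + (q - p))), q + 1,
      by rw [e, neg_smul, sub_eq_add_neg], Or.inr h2, ?_⟩
    obtain ⟨h3, h4⟩ := ratio_lay h1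
    obtain ⟨h5, h6⟩ := ratio_end h
    have hq : L ≤ q := by
      by_contra hc
      exact hs ⟨σ, p, q, q - p, h, by omega, by omega, rfl⟩
    have := U_anti_lay hL (show L + 1 ≤ q + 1 by omega)
    rw [abs_neg, abs_of_nonneg h3, abs_of_nonneg h5]
    linarith

theorem norm_pow_comb_le {S : L1 →L[ℝ] L1} {α β K B : ℝ} {x y : L1} (hx : ‖S x‖ ≤ K)
    (hy : ‖S y‖ ≤ K) (hK : 0 ≤ K) (h : |α| + |β| ≤ B) : ‖S (α • x + β • y)‖ ≤ B * K := by
  rw [map_add, map_smul, map_smul]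
  refine (norm_comb_le _ _ _ _).trans ?_
  calc |α| * ‖S x‖ + |β| * ‖S y‖ ≤ |α| * K + |β| * K := by gcongr
    _ = (|α| + |β|) * K := by ring
    _ ≤ B * K := by gcongr

theorem norm_T_pow_le (l : ℕ) :
    ∃ C : ℝ, 0 < C ∧ ∀ n, ‖T ^ n‖ ≤ C * (1 / (N l + 3 : ℝ)) ^ n := by
  set L := N l with hLdef
  have hL : Lay (L + 1) := lay_after (k := l) (by omega) (by omega)
  set κ : ℝ := (L + 3 : ℝ) with hκ
  have hκ3 : 3 ≤ κ := by have : (0 : ℝ) ≤ L := by positivity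
                         linarith
  have hκ1 : 1 ≤ κ := by linarith
  have hκ0 : 0 < κ := by linarith
  set ε : ℝ := 1 / κ with hε
  have hε0 : 0 < ε := by positivity
  have hεκ : ε * κ = 1 := by rw [hε]; field_simp
  have hwL := w_pos L
  have hwL1 := w_le_one L
  set g : ℝ := κ ^ (L + 1) / w L with hg
  have hG0 : (1 : ℝ) ≤ κ ^ (L + 1) := one_le_pow₀ hκ1
  have hg1 : κ ^ (L + 1) ≤ g := le_div_self (by positivity) hwL hwL1
  set G1 : ℝ := κ * (1 + g) with hG1
  have hG1g : 1 + g ≤ G1 := le_mul_of_one_le_left (by linarith) hκ1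
  set G : ℝ := G1 * κ ^ L with hG
  have hGG1 : G1 ≤ G := le_mul_of_one_le_right (by linarith) (one_le_pow₀ hκ1)
  -- the main smallness estimate
  have hV : 2 * U (L + 1) * G ≤ ε := by
    have h1 : U (L + 1) ≤ (w L / κ) ^ (2 * L + 5) := by
      have := Phi_le_pow (L + 1) (w_pos L) hwL1 (n := 2 * L + 5) (by omega)
      have e : ((L + 1 : ℕ) : ℝ) + 2 = κ := by push_cast; rw [hκ]; ring
      rw [e] at this
      exact this
    have h2 : (w L / κ) ^ (2 * L + 5) ≤ w L * ε ^ (2 * L + 5) := by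
      rw [div_eq_mul_one_div, mul_pow]
      refine mul_le_mul_of_nonneg_right ?_ (by positivity)
      calc w L ^ (2 * L + 5) ≤ w L ^ 1 := pow_le_pow_of_le_one hwL.le hwL1 (by omega)
        _ = w L := pow_one _
    have h3 : G ≤ 2 * κ ^ (2 * L + 2) / w L := by
      have : G ≤ κ * (g + g) * κ ^ L := by
        rw [hG, hG1]; gcongr; linarith
      refine this.trans (le_of_eq ?_)
      rw [hg]; field_simp; ring
    have h4 : 2 * U (L + 1) * G ≤ 2 * (w L * ε ^ (2 * L + 5)) * (2 * κ ^ (2 * L + 2) / w L) := by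
      gcongr
      exact h1.trans h2
    have h5 : 2 * (w L * ε ^ (2 * L + 5)) * (2 * κ ^ (2 * L + 2) / w L) = 4 * ε ^ 3 := by
      have : ε ^ (2 * L + 5) = ε ^ (2 * L + 2) * ε ^ 3 := by rw [← pow_add]
      have h6 : ε ^ (2 * L + 2) * κ ^ (2 * L + 2) = 1 := by rw [← mul_pow, hεκ, one_pow]
      rw [this]
      calc _ = 4 * (ε ^ (2 * L + 2) * κ ^ (2 * L + 2)) * ε ^ 3 * (w L / w L) := by ring
        _ = _ := by rw [h6, div_self hwL.ne']; ring
    have h7 : ε ≤ 1 / 3 := by rw [hε]; exact one_div_le_one_div_of_le (by norm_num) hκ3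
    rw [h5] at h4
    nlinarith [mul_pos hε0 hε0]
  have main : ∀ n : ℕ,
      (∀ j ≤ L, ‖(T ^ n) (ev j)‖ ≤ ε ^ n * κ ^ (L + 1 - j)) ∧
      (∀ i, L < i → ¬ Special L i → ‖(T ^ n) (fv i)‖ ≤ ε ^ n) ∧
      (∀ σ p q j, Fan σ p q → q < L → j ≤ q - p → L < σ + j →
        ‖(T ^ n) (fv (σ + j))‖ ≤ ε ^ n * (G1 * κ ^ (L - j))) ∧
      (∀ r, r ≤ L → r = 0 ∨ Lay r → ‖(T ^ n) (fv r)‖ ≤ ε ^ n * g) ∧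
      (∀ i, L < i → ‖(T ^ n) (fv i)‖ ≤ ε ^ n * G) ∧
      (∀ r, r = 0 ∨ Lay r → ‖(T ^ n) (fv r)‖ ≤ ε ^ n * G) := by
    have step : ∀ n : ℕ,
      (∀ j ≤ L, ‖(T ^ n) (ev j)‖ ≤ ε ^ n * κ ^ (L + 1 - j)) →
      (∀ i, L < i → ¬ Special L i → ‖(T ^ n) (fv i)‖ ≤ ε ^ n) →
      (∀ σ p q j, Fan σ p q → q < L → j ≤ q - p → L < σ + j →
        ‖(T ^ n) (fv (σ + j))‖ ≤ ε ^ n * (G1 * κ ^ (L - j))) →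
      (∀ r, r ≤ L → r = 0 ∨ Lay r → ‖(T ^ n) (fv r)‖ ≤ ε ^ n * g) ∧
      (∀ i, L < i → ‖(T ^ n) (fv i)‖ ≤ ε ^ n * G) ∧
      (∀ r, r = 0 ∨ Lay r → ‖(T ^ n) (fv r)‖ ≤ ε ^ n * G) := by
      intro n hA hC hD
      have hεn : 0 < ε ^ n := by positivity
      have h1 : ∀ r, r ≤ L → r = 0 ∨ Lay r → ‖(T ^ n) (fv r)‖ ≤ ε ^ n * g := by
        intro r hr h
        have hw := w_pos r
        have e : fv r = (w r)⁻¹ • ev r := by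
          rw [eq_inv_smul_iff₀ hw.ne']
          rcases h with rfl | h
          · rw [ev_zero, w_zero, one_smul]
          · rw [ev_lay h]
        rw [e, map_smul, norm_smul, Real.norm_of_nonneg (by positivity), hg, div_eq_inv_mul]
        calc (w r)⁻¹ * ‖(T ^ n) (ev r)‖ ≤ (w L)⁻¹ * (ε ^ n * κ ^ (L + 1)) := by
              have h3 : κ ^ (L + 1 - r) ≤ κ ^ (L + 1) := pow_le_pow_right₀ hκ1 (by omega)
              have h4 : (w r)⁻¹ ≤ (w L)⁻¹ := inv_anti₀ hwL (w_anti hr)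
              have h5 := hA r hr
              have : ‖(T ^ n) (ev r)‖ ≤ ε ^ n * κ ^ (L + 1) :=
                h5.trans (mul_le_mul_of_nonneg_left h3 hεn.le)
              gcongr
          _ = _ := by ring
      have h2 : ∀ i, L < i → ‖(T ^ n) (fv i)‖ ≤ ε ^ n * G := by
        intro i hi
        by_cases hs : Special L i
        · obtain ⟨σ, p, q, j, h, hq, hj, rfl⟩ := hs
          refine (hD σ p q j h hq hj hi).trans (mul_le_mul_of_nonneg_left ?_ hεn.le)
          rw [hG]
          refine mul_le_mul_of_nonneg_left (pow_le_pow_right₀ hκ1 (by omega)) (by linarith)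
        · refine (hC i hi hs).trans (le_mul_of_one_le_right hεn.le ?_)
          linarith
      refine ⟨h1, h2, fun r hr => ?_⟩
      rcases le_or_gt r L with h | h
      · refine (h1 r h hr).trans (mul_le_mul_of_nonneg_left ?_ hεn.le)
        linarith
      · exact h2 r h
    intro n
    induction n with
    | zero =>
      have hA : ∀ j ≤ L, ‖(T ^ 0) (ev j)‖ ≤ ε ^ 0 * κ ^ (L + 1 - j) := by
        intro j _
        rw [pow_zero, pow_zero, one_mul]
        exact (norm_ev_le_one j).trans (one_le_pow₀ hκ1)
      have hC : ∀ i, L < i → ¬ Special L i → ‖(T ^ 0) (fv i)‖ ≤ ε ^ 0 := by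
        intro i _ _
        rw [pow_zero, pow_zero]
        exact (norm_fv i).le
      have hD : ∀ σ p q j, Fan σ p q → q < L → j ≤ q - p → L < σ + j →
          ‖(T ^ 0) (fv (σ + j))‖ ≤ ε ^ 0 * (G1 * κ ^ (L - j)) := by
        intro σ p q j _ _ _ _
        rw [pow_zero, pow_zero, one_mul]
        refine (norm_fv _).le.trans ?_
        exact one_le_mul_of_one_le_of_one_le (by linarith) (one_le_pow₀ hκ1)
      exact ⟨hA, hC, hD, step 0 hA hC hD⟩
    | succ n ih =>
      obtain ⟨iA, iC, iD, iE, iF, iR⟩ := ih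
      have hεn : 0 < ε ^ n := by positivity
      have hA : ∀ j ≤ L, ‖(T ^ (n + 1)) (ev j)‖ ≤ ε ^ (n + 1) * κ ^ (L + 1 - j) := by
        intro j hj
        rw [pow_succ, mul_apply_eq_comp, T_ev]
        rcases hj.lt_or_eq with h | rfl
        · refine (iA (j + 1) h).trans (le_of_eq ?_)
          have : L + 1 - j = (L + 1 - (j + 1)) + 1 := by omega
          rw [this, pow_succ, pow_succ]
          calc _ = ε ^ n * κ ^ (L + 1 - (j + 1)) * 1 := by ring
            _ = _ := by rw [← hεκ]; ring
        · rw [ev_lay hL, map_smul, norm_smul, Real.norm_of_nonneg (w_pos _).le]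
          have h1 := iC (L + 1) (by omega) (fun h => h.not_lay hL)
          have : L + 1 - L = 1 := by omega
          rw [this, pow_one, pow_succ, mul_assoc, hεκ, mul_one]
          calc w (L + 1) * ‖(T ^ n) (fv (L + 1))‖ ≤ 1 * ε ^ n := by
                gcongr
                exact w_le_one _
            _ = _ := one_mul _
      have hC : ∀ i, L < i → ¬ Special L i → ‖(T ^ (n + 1)) (fv i)‖ ≤ ε ^ (n + 1) := by
        intro i hi hs
        rw [pow_succ T, mul_apply_eq_comp, T_fv]
        obtain ⟨α, β, r, e, hr, hab⟩ := Tu_of_not_special hL hi hs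
        rw [e]
        refine (norm_pow_comb_le (iF (i + 1) (by omega)) (iR r hr)
          (by positivity) hab).trans ?_
        calc 2 * U (L + 1) * (ε ^ n * G) = ε ^ n * (2 * U (L + 1) * G) := by ring
          _ ≤ ε ^ n * ε := by gcongr
          _ = _ := (pow_succ _ _).symm
      have hD : ∀ σ p q j, Fan σ p q → q < L → j ≤ q - p → L < σ + j →
          ‖(T ^ (n + 1)) (fv (σ + j))‖ ≤ ε ^ (n + 1) * (G1 * κ ^ (L - j)) := by
        intro σ p q j h hq hj hi
        rw [pow_succ T, mul_apply_eq_comp, T_fv]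
        have key : ∀ i, i = σ + j → ‖(T ^ n) (Tu i)‖ ≤ ε ^ (n + 1) * (G1 * κ ^ (L - j)) := by
          intro i hij
          rcases Tu_cases i with ⟨hc, -, -⟩ | ⟨hc, -⟩ | ⟨σ', p', q', j', h', hj', e', e⟩ |
            ⟨σ', p', q', h', e', h1, h2, e⟩
          · rw [hij, cc_fan h hj] at hc
            exact absurd hc (U_pos σ).ne'
          · rw [hij, cc_fan h hj] at hc
            exact absurd hc (U_pos σ).ne'
          · obtain ⟨-, d1, d2, d3⟩ := h.data hj
            obtain ⟨-, d1', d2', d3'⟩ := h'.data hj'.le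
            have eij : σ + j = σ' + j' := by omega
            rw [eij] at d1 d2 d3
            have hjj : j + 1 ≤ q - p := by omega
            rw [e, map_smul, norm_smul, Real.norm_of_nonneg (U_pos _).le, hij]
            have h3 := iD σ p q (j + 1) h hq hjj (by omega)
            have : L - j = (L - (j + 1)) + 1 := by omega
            rw [this, pow_succ, pow_succ]
            calc U (q' + 1) * ‖(T ^ n) (fv (σ + j + 1))‖
                ≤ 1 * (ε ^ n * (G1 * κ ^ (L - (j + 1)))) := by
                  gcongr
                  · exact U_le_one _
                  · exact h3
              _ = ε ^ n * (G1 * κ ^ (L - (j + 1))) * (ε * κ) := by rw [hεκ]; ring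
              _ = _ := by ring
          · obtain ⟨-, d1, d2, d3⟩ := h.data hj
            obtain ⟨-, d1', d2', d3'⟩ := h'.data (j := q' - p') le_rfl
            have eij : σ + j = σ' + (q' - p') := by omega
            rw [eij] at d1 d2 d3
            have hqq : q' = q := by omega
            have hni := iC (i + 1) (by omega) (fun hh => hh.not_lay h1)
            have hnq := iE (q' + 1) (by omega) (Or.inr h2)
            rw [e, map_sub, map_smul, map_smul]
            refine (norm_sub_le _ _).trans ?_
            obtain ⟨h3, h4⟩ := ratio_lay h1
            obtain ⟨h5, h6⟩ := ratio_end h'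
            rw [← e'] at h5 h6
            have h7 := U_le_one (q' + 1)
            have h8 := w_le_one i
            rw [norm_smul, norm_smul, Real.norm_of_nonneg h3, Real.norm_of_nonneg h5]
            calc _ ≤ 1 * ε ^ n + 1 * (ε ^ n * g) := by
                  refine add_le_add (mul_le_mul (by linarith) hni (norm_nonneg _) zero_le_one)
                    (mul_le_mul (by linarith) hnq (norm_nonneg _) zero_le_one)
              _ = ε ^ n * (ε * κ) * (1 + g) := by rw [hεκ]; ring
              _ = ε ^ (n + 1) * G1 := by rw [hG1, pow_succ]; ring
              _ ≤ _ := by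
                  refine mul_le_mul_of_nonneg_left ?_ (by positivity)
                  exact le_mul_of_one_le_right (by linarith) (one_le_pow₀ hκ1)
        exact key _ rfl
      exact ⟨hA, hC, hD, step (n + 1) hA hC hD⟩
  refine ⟨G + 2 * g, by linarith, fun n => norm_clm_le _ fun i => ?_⟩
  obtain ⟨iA, -, -, -, iF, -⟩ := main n
  have hεn : 0 < ε ^ n := by positivity
  rcases le_or_gt i L with hi | hi
  · have hb : ∀ j ≤ L, ‖(T ^ n) (ev j)‖ ≤ ε ^ n * κ ^ (L + 1) := fun j hj =>
      (iA j hj).trans (mul_le_mul_of_nonneg_left (pow_le_pow_right₀ hκ1 (by omega)) hεn.le)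
    rw [fv_eq, map_smul, map_sub, map_smul, norm_smul,
      Real.norm_of_nonneg (inv_nonneg.2 (w_pos i).le)]
    have h4 : (w i)⁻¹ ≤ (w L)⁻¹ := inv_anti₀ hwL (w_anti hi)
    have h5 : ‖(T ^ n) (ev i) - cc i • (T ^ n) (ev (rho i))‖ ≤ 2 * (ε ^ n * κ ^ (L + 1)) := by
      refine (norm_sub_le _ _).trans ?_
      rw [norm_smul, Real.norm_of_nonneg (cc_nonneg i)]
      have h6 := hb i hi
      have h7 := hb (rho i) ((rho_le i).trans hi)
      have h8 := mul_le_of_le_one_left (norm_nonneg ((T ^ n) (ev (rho i)))) (cc_le_one i)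
      linarith
    have hG0 : 0 ≤ G := by linarith
    calc (w i)⁻¹ * ‖(T ^ n) (ev i) - cc i • (T ^ n) (ev (rho i))‖
        ≤ (w L)⁻¹ * (2 * (ε ^ n * κ ^ (L + 1))) := by gcongr
      _ = 2 * g * ε ^ n := by rw [hg]; ring
      _ ≤ _ := by gcongr; linarith
  · have := iF i hi
    nlinarith

theorem tendsto_norm_pow : Tendsto (fun n : ℕ => ‖T ^ n‖ ^ (1 / (n : ℝ))) atTop (nhds 0) := by
  rw [Metric.tendsto_atTop]
  intro η hη
  obtain ⟨l, hl⟩ := exists_nat_gt (2 / η)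
  obtain ⟨C, hC, h⟩ := norm_T_pow_le l
  have hl' : (l : ℝ) ≤ N l := by exact_mod_cast le_N l
  set ε : ℝ := 1 / (N l + 3 : ℝ) with hε
  have hε0 : 0 < ε := by positivity
  have hεη : 2 * ε < η := by
    rw [hε, mul_one_div, div_lt_iff₀ (by positivity)]
    rw [div_lt_iff₀ hη] at hl
    nlinarith
  have hlim : Tendsto (fun n : ℕ => C ^ (1 / (n : ℝ))) atTop (𝓝 1) := by
    have h1 : Tendsto (fun n : ℕ => 1 / (n : ℝ)) atTop (𝓝 0) := tendsto_one_div_atTop_nhds_zero_nat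
    have := (Real.continuousAt_const_rpow (a := C) (b := 0) hC.ne').tendsto.comp h1
    simpa [Function.comp_def] using this
  have hev : ∀ᶠ n : ℕ in atTop, C ^ (1 / (n : ℝ)) < 2 :=
    hlim.eventually (gt_mem_nhds (by norm_num))
  obtain ⟨n0, hn0⟩ := eventually_atTop.1 (hev.and (eventually_ge_atTop 1))
  refine ⟨n0, fun n hn => ?_⟩
  obtain ⟨h1, h2⟩ := hn0 n hn
  have hn0 : (n : ℝ) ≠ 0 := by positivity
  rw [Real.dist_eq, sub_zero, abs_of_nonneg (by positivity)]
  calc ‖T ^ n‖ ^ (1 / (n : ℝ)) ≤ (C * ε ^ n) ^ (1 / (n : ℝ)) :=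
        Real.rpow_le_rpow (norm_nonneg _) (h n) (by positivity)
    _ = C ^ (1 / (n : ℝ)) * ε := by
        rw [Real.mul_rpow hC.le (by positivity), ← Real.rpow_natCast ε n,
          ← Real.rpow_mul hε0.le, mul_one_div_cancel hn0, Real.rpow_one]
    _ ≤ 2 * ε := by gcongr
    _ < η := hεη

/-- Indices of later fans copying blocks already present at step `k`. -/
def Bad (k i : ℕ) : Prop := ∃ k', k < k' ∧ src k' ≤ k ∧ ∃ t ≤ N (src k'), i = sa k' + t

theorem Bad.lt {k i : ℕ} (h : Bad k i) : N (k + 1) < i := by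
  obtain ⟨k', h1, -, t, -, rfl⟩ := h
  have := N_mono (show k + 1 ≤ k' by omega)
  have := consts k'
  omega

theorem Bad.rho_le {k i : ℕ} (h : Bad k i) : rho i ≤ N k := by
  obtain ⟨k', h1, h2, t, ht, rfl⟩ := h
  rw [rho_fan (Fan.a k') (by omega)]
  have := N_mono h2
  omega

theorem cc_div_w_le {k t : ℕ} (ht : t ≤ N (src k)) :
    cc (sa k + t) / w (sa k + t) ≤ 1 / w (N (src k) + 1) := by
  have hF := Fan.a k
  have hj : t ≤ N (src k) - 0 := by omega
  rw [cc_fan hF hj, w_fan hF t hj]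
  have h1 := U_pos (sa k)
  have h2 := U_pos (N (src k) + 1)
  have h3 := w_pos (N (src k) + 1)
  rw [div_le_div_iff₀ (by positivity) h3, one_mul]
  refine mul_le_mul_of_nonneg_left ?_ h1.le
  have h5 := w_lay_le_pow (hF.lay_gap_src (r := 1) le_rfl (by omega)) (n := N (src k) + 1)
    (by omega) (by omega)
  have h6 : U (N (src k) + 1) ^ (N (src k) + 1) ≤ U (N (src k) + 1) ^ (t + 1) :=
    pow_le_pow_of_le_one h2.le (U_le_one _) (by omega)
  have : 0 < U (N (src k) + 1) ^ (N (src k) + 1) := by positivity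
  linarith

open Classical in
/-- Matrix entries of the coefficient functionals. -/
def gam (k j i : ℕ) : ℝ :=
  if i ≤ M k ∨ Bad k i then
    ((if i ≤ M k ∧ j = i then 1 else 0) - (if j = rho i then cc i else 0)) / w i
  else 0

theorem abs_gam_le (k j i : ℕ) : ‖gam k j i‖ ≤ 2 / w (M k) := by
  have hM := w_pos (M k)
  have hi := w_pos i
  have hc0 := cc_nonneg i
  have hc1 := cc_le_one i
  rw [Real.norm_eq_abs]
  unfold gam
  split_ifs with h h1 h2 h2
  · rw [abs_div, abs_of_pos hi]
    have := w_anti h1.1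
    refine div_le_div₀ zero_le_two ?_ hM this
    rw [abs_le]; constructor <;> linarith
  · rw [abs_div, abs_of_pos hi]
    have := w_anti h1.1
    refine div_le_div₀ zero_le_two ?_ hM this
    norm_num
  · rcases h with h | h
    · rw [abs_div, abs_of_pos hi]
      have := w_anti h
      refine div_le_div₀ zero_le_two ?_ hM this
      rw [abs_le]; constructor <;> linarith
    · rw [zero_sub, neg_div, abs_neg, abs_of_nonneg (by positivity)]
      obtain ⟨k', h1, h3, t, ht, rfl⟩ := h
      refine (cc_div_w_le ht).trans ?_
      refine div_le_div₀ zero_le_two (by norm_num) hM (w_anti ?_)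
      have := consts k
      have := N_mono h3
      omega
  · simp; positivity
  · simp; positivity

/-- The coefficient functionals of step `k`. -/
def cf (k j : ℕ) : L1 →L[ℝ] ℝ := lift (gam k j) (2 / w (M k)) (abs_gam_le k j)

theorem cf_fv (k j i : ℕ) : cf k j (fv i) = gam k j i := lift_fv _ _ _ _

theorem abs_cf_le (k j : ℕ) (x : L1) : |cf k j x| ≤ 2 / w (M k) * ‖x‖ := by
  have := norm_clm_apply_le (cf k j) (K := 2 / w (M k))
    (fun i => by rw [cf_fv]; exact abs_gam_le k j i) x
  simpa using this

/-- The projections onto the span of the first vectors of the orbit. -/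
def Q (k : ℕ) : L1 →L[ℝ] L1 := ∑ j ∈ Finset.range (M k + 1), (cf k j).smulRight (ev j)

theorem Q_apply (k : ℕ) (x : L1) :
    Q k x = ∑ j ∈ Finset.range (M k + 1), cf k j x • ev j := by
  simp [Q, sum_apply]

theorem Q_fv_le {k i : ℕ} (h : i ≤ M k) : Q k (fv i) = fv i := by
  classical
  rw [Q_apply]
  have e : ∀ j, cf k j (fv i) • ev j =
      (w i)⁻¹ • ((if i = j then ev j else 0) - (if rho i = j then cc i • ev j else 0)) := by
    intro j
    rw [cf_fv, gam, if_pos (Or.inl h), div_eq_inv_mul, mul_smul, sub_smul]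
    congr 2
    · by_cases hj : i = j
      · rw [if_pos hj, if_pos ⟨h, hj.symm⟩, one_smul]
      · rw [if_neg hj, if_neg (fun hh => hj hh.2.symm), zero_smul]
    · by_cases hj : rho i = j
      · rw [if_pos hj, if_pos hj.symm]
      · rw [if_neg hj, if_neg (Ne.symm hj), zero_smul]
  simp only [e]
  rw [← Finset.smul_sum, Finset.sum_sub_distrib, Finset.sum_ite_eq, Finset.sum_ite_eq,
    if_pos (by simp; omega), if_pos (by have := ReadOp.rho_le i; simp; omega), ← fv_eq]

theorem Q_fv_bad {k i : ℕ} (h : Bad k i) : Q k (fv i) = -((cc i / w i) • ev (rho i)) := by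
  classical
  have hi : ¬ i ≤ M k := by have := h.lt; have := consts k; omega
  rw [Q_apply]
  have e : ∀ j, cf k j (fv i) • ev j =
      (if rho i = j then -((cc i / w i) • ev j) else 0) := by
    intro j
    rw [cf_fv, gam, if_pos (Or.inr h), if_neg (fun hh => hi hh.1)]
    by_cases hj : rho i = j
    · rw [if_pos hj, if_pos hj.symm, zero_sub, neg_div, neg_smul]
    · rw [if_neg hj, if_neg (Ne.symm hj)]; simp
  simp only [e]
  rw [Finset.sum_ite_eq, if_pos]
  have := h.rho_le
  have := consts k
  simp; omega

theorem Q_fv_else {k i : ℕ} (h : ¬ i ≤ M k) (h' : ¬ Bad k i) : Q k (fv i) = 0 := by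
  rw [Q_apply]
  refine Finset.sum_eq_zero fun j _ => ?_
  rw [cf_fv, gam, if_neg (by tauto), zero_smul]

theorem norm_inv_smul_lay {i m : ℕ} (hm : Lay m) (h : i < m) :
    ‖(w i)⁻¹ • ev m‖ ≤ w i / 2 := by
  have hi := w_pos i
  rw [ev_lay hm, norm_smul, norm_smul, norm_fv, mul_one, Real.norm_of_nonneg (by positivity),
    Real.norm_of_nonneg (w_pos m).le, inv_mul_le_iff₀ hi]
  have h1 := w_lay_le hm
  have h2 := U_le_w h
  have h3 := U_pos m
  nlinarith

/-- A variant of `norm_inv_smul_lay` where an intermediate index provides the bound. -/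
theorem norm_inv_smul_lay' {i n m : ℕ} (hm : Lay m) (h : n < m) (hin : i ≤ n) :
    ‖(w i)⁻¹ • ev m‖ ≤ w n / 2 := by
  refine le_trans ?_ (norm_inv_smul_lay hm h)
  rw [norm_smul, norm_smul]
  refine mul_le_mul_of_nonneg_right ?_ (norm_nonneg _)
  rw [Real.norm_of_nonneg (inv_nonneg.2 (w_pos _).le),
    Real.norm_of_nonneg (inv_nonneg.2 (w_pos _).le)]
  exact inv_anti₀ (w_pos n) (w_anti hin)

theorem w_N_succ_le (k : ℕ) : w (N (k + 1)) ≤ U (sb k + ss k) * U (M k + 1) := by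
  have h := consts k
  have e : N (k + 1) = sb k + ss k + (M k - ss k) := by omega
  rw [e, w_fan (Fan.b k) _ le_rfl]
  refine mul_le_mul_of_nonneg_left ?_ (U_pos _).le
  calc U (M k + 1) ^ (M k - ss k + 1) ≤ U (M k + 1) ^ 1 :=
        pow_le_pow_of_le_one (U_pos _).le (U_le_one _) (by omega)
    _ = _ := pow_one _

theorem tail_fan {i d k σ p q j : ℕ} (h : Fan σ p q) (hj : j ≤ q - p) (hi : i = σ + j)
    (hd : 1 ≤ d) (hdq : d ≤ q) (hN : N (k + 1) ≤ q) : ‖(T ^ d) (fv i)‖ ≤ w (N (k + 1)) := by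
  subst hi
  have hle := h.le
  have hlt := h.lt
  have hwi := w_pos (σ + j)
  have hwN := w_pos (N (k + 1))
  have hUq := U_pos (q + 1)
  have hUq1 := U_le_one (q + 1)
  have hUs := U_pos σ
  have hUN : U (q + 1) ≤ w (N (k + 1)) / 2 :=
    (U_succ_le_half q).trans (by have := w_anti hN; linarith)
  rw [T_pow_fv, cc_fan h hj, rho_fan h hj]
  rcases le_or_gt (j + d) (q - p) with hc | hc
  · have e1 := ev_fan h hc
    rw [← add_assoc σ j d] at e1
    rw [e1, add_assoc p j d, add_sub_cancel_right, smul_smul, norm_smul, norm_fv, mul_one,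
      Real.norm_of_nonneg (mul_nonneg (inv_nonneg.2 hwi.le) (w_pos _).le), inv_mul_le_iff₀ hwi,
      add_assoc σ j d, w_fan h _ hj, w_fan h _ hc]
    have e2 : U (q + 1) ^ (j + d + 1) = U (q + 1) ^ (j + 1) * U (q + 1) ^ d := by
      rw [← pow_add]; congr 1; omega
    have e3 : U (q + 1) ^ d ≤ w (N (k + 1)) := by
      calc U (q + 1) ^ d ≤ U (q + 1) ^ 1 := pow_le_pow_of_le_one hUq.le hUq1 hd
        _ ≤ _ := by rw [pow_one]; linarith
    rw [e2, ← mul_assoc]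
    exact mul_le_mul_of_nonneg_left e3 (by positivity)
  · obtain ⟨r, hr⟩ : ∃ r, j + d = q - p + r := ⟨j + d - (q - p), by omega⟩
    have l1 := h.lay_gap (r := r) (by omega) (by omega)
    have l2 := h.lay_gap_src (r := r) (by omega) (by omega)
    have e1 : σ + j + d = σ + (q - p) + r := by omega
    have e2 : p + j + d = q + r := by omega
    rw [e1, e2, smul_sub]
    refine (norm_sub_le _ _).trans ?_
    have h1 : ‖(w (σ + j))⁻¹ • ev (σ + (q - p) + r)‖ ≤ w (N (k + 1)) / 2 := by
      refine (norm_inv_smul_lay l1 (by omega)).trans ?_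
      have := w_anti (show N (k + 1) ≤ σ + j by omega)
      linarith
    have h2 : ‖(w (σ + j))⁻¹ • U σ • ev (q + r)‖ ≤ w (N (k + 1)) / 2 := by
      rw [ev_lay l2, norm_smul, norm_smul, norm_smul, norm_fv, mul_one,
        Real.norm_of_nonneg (inv_nonneg.2 hwi.le), Real.norm_of_nonneg hUs.le,
        Real.norm_of_nonneg (w_pos _).le, inv_mul_le_iff₀ hwi, w_fan h _ hj, mul_assoc]
      refine mul_le_mul_of_nonneg_left ?_ hUs.le
      have h5 := w_lay_le_pow (h.lay_gap_src (r := 1) le_rfl (by omega)) (n := q + 2)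
        (by omega) (by omega)
      have h6 : U (q + 1) ^ (q + 2) ≤ U (q + 1) ^ (j + 1 + 1) :=
        pow_le_pow_of_le_one hUq.le hUq1 (by omega)
      rw [pow_succ _ (j + 1)] at h6
      have h7 : w (q + r) ≤ w (q + 1) := w_anti (by omega)
      have h8 : U (q + 1) ^ (j + 1) * U (q + 1) ≤ U (q + 1) ^ (j + 1) * (w (N (k + 1)) / 2) :=
        mul_le_mul_of_nonneg_left hUN (by positivity)
      have h9 : 0 < U (q + 1) ^ (q + 2) := by positivity
      linarith
    linarith

theorem norm_tail_fv_le (k i : ℕ) :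
    ‖(T ^ (ss k + sb k)) (fv i - Q k (fv i))‖ ≤ w (N (k + 1)) := by
  have hN := w_pos (N (k + 1))
  have hk := consts k
  have hk1 := consts (k + 1)
  by_cases hiM : i ≤ M k
  · rw [Q_fv_le hiM, sub_self, map_zero, norm_zero]; exact hN.le
  by_cases hb : Bad k i
  · have e : fv i - Q k (fv i) = (w i)⁻¹ • ev i := by
      rw [Q_fv_bad hb, fv_eq i, smul_sub, smul_smul, div_eq_inv_mul]
      abel
    have hlt := hb.lt
    rw [e, map_smul, T_pow_ev]
    obtain ⟨k', h1, h2, t, ht, rfl⟩ := hb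
    have hk' := consts k'
    have := N_mono h2
    have := N_mono (show k + 1 ≤ k' by omega)
    have hl : Lay (sa k' + t + (ss k + sb k)) :=
      lay_between (k := k') (by omega) (by omega)
    refine (norm_inv_smul_lay hl (by omega)).trans ?_
    have := w_anti hlt.le
    have := w_pos (sa k' + t)
    linarith
  rw [Q_fv_else hiM hb, sub_zero]
  rcases le_or_gt i (N (k + 1)) with hiN | hiN
  · rw [T_pow_fv]
    rcases lt_or_ge i (sb k + ss k) with h | h
    · have hl : Lay i := lay_between (k := k) (by omega) h
      rw [cc_lay hl, zero_smul, sub_zero]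
      have := norm_inv_smul_lay' (i := i) (n := N (k + 1)) (m := i + (ss k + sb k))
        (lay_after (k := k + 1) (by omega) (by omega)) (by omega) hiN
      linarith
    · obtain ⟨j, rfl⟩ : ∃ j, i = sb k + ss k + j := ⟨i - (sb k + ss k), by omega⟩
      have hj : j ≤ M k - ss k := by omega
      rw [cc_fan (Fan.b k) hj, rho_fan (Fan.b k) hj, smul_sub]
      refine (norm_sub_le _ _).trans ?_
      have h1 := norm_inv_smul_lay' (i := sb k + ss k + j) (n := N (k + 1))
        (m := sb k + ss k + j + (ss k + sb k))
        (lay_after (k := k + 1) (by omega) (by omega)) (by omega) hiN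
      have h2 := norm_inv_smul_lay' (i := sb k + ss k + j) (n := N (k + 1))
        (m := ss k + j + (ss k + sb k))
        (lay_after (k := k + 1) (by omega) (by omega)) (by omega) hiN
      have h3 : ‖(w (sb k + ss k + j))⁻¹ • U (sb k + ss k) • ev (ss k + j + (ss k + sb k))‖ ≤
          ‖(w (sb k + ss k + j))⁻¹ • ev (ss k + j + (ss k + sb k))‖ := by
        rw [smul_comm, norm_smul, Real.norm_of_nonneg (U_pos _).le]
        exact mul_le_of_le_one_left (norm_nonneg _) (U_le_one _)
      linarith
  · rcases lay_or_fan (i := i) (by omega) with h | ⟨σ, p, q, j, h, hj, hi⟩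
    · rw [T_pow_fv, cc_lay h, zero_smul, sub_zero, norm_smul,
        Real.norm_of_nonneg (inv_nonneg.2 (w_pos _).le), inv_mul_le_iff₀ (w_pos i)]
      refine (norm_ev_le_of_lay h (by omega)).trans ?_
      rw [sq]
      exact mul_le_mul_of_nonneg_left (w_anti hiN.le) (w_pos i).le
    · have hq : N (k + 1) ≤ q := by
        cases h with
        | a k' =>
          have hk' := consts k'
          have h1 : k + 1 ≤ k' := by
            by_contra hc
            have := N_mono (show k' + 1 ≤ k + 1 by omega)
            omega
          by_contra hc
          refine hb ⟨k', by omega, ?_, j, by omega, hi⟩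
          by_contra hc'
          exact hc (N_mono (by omega))
        | b k' =>
          have hk' := consts k'
          have h1 : k + 1 ≤ k' := by
            by_contra hc
            have := N_mono (show k' + 1 ≤ k + 1 by omega)
            omega
          have := N_mono h1
          omega
      exact tail_fan h hj hi (by omega) (by omega) hq

theorem norm_tail_le (k : ℕ) (x : L1) :
    ‖(T ^ (ss k + sb k)) (x - Q k x)‖ ≤ U (sb k + ss k) * U (M k + 1) * ‖x‖ := by
  have := norm_clm_apply_le ((T ^ (ss k + sb k)).comp (ContinuousLinearMap.id ℝ L1 - Q k))
    (K := U (sb k + ss k) * U (M k + 1)) (fun i => by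
      simpa using (norm_tail_fv_le k i).trans (w_N_succ_le k)) x
  simpa using this

theorem norm_shift_ev_le {k j : ℕ} (hj : j ≤ M k) :
    ‖(T ^ (ss k + sb k)) (ev j) - U (sb k + ss k) • (T ^ (ss k)) (ev j)‖ ≤
      2 * (U (sb k + ss k) * U (M k + 1)) := by
  have hk := consts k
  have hk1 := consts (k + 1)
  have hB := U_pos (sb k + ss k)
  have hU := U_pos (M k + 1)
  rw [T_pow_ev, T_pow_ev]
  rcases le_or_gt j (M k - ss k) with h | h
  · have e : j + (ss k + sb k) = sb k + ss k + j := by ring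
    rw [e, ev_fan (Fan.b k) h, add_comm j (ss k), add_sub_cancel_right, norm_smul, norm_fv,
      mul_one, Real.norm_of_nonneg (w_pos _).le, w_fan (Fan.b k) _ h]
    have : U (M k + 1) ^ (j + 1) ≤ U (M k + 1) ^ 1 :=
      pow_le_pow_of_le_one hU.le (U_le_one _) (by omega)
    rw [pow_one] at this
    have h2 := mul_le_mul_of_nonneg_left this hB.le
    have : 0 < U (sb k + ss k) * U (M k + 1) := by positivity
    linarith
  · have l1 : Lay (j + (ss k + sb k)) := lay_after (k := k + 1) (by omega) (by omega)
    have l2 : Lay (j + ss k) := lay_between (k := k) (by omega) (by omega)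
    have l3 : Lay (M k + 1) := lay_between (k := k) (by omega) (by omega)
    refine (norm_sub_le _ _).trans ?_
    rw [ev_lay l1, ev_lay l2, norm_smul, norm_smul, norm_smul, norm_fv, norm_fv, mul_one, mul_one,
      Real.norm_of_nonneg (w_pos _).le, Real.norm_of_nonneg (w_pos _).le,
      Real.norm_of_nonneg hB.le]
    have h1 := w_anti (show N (k + 1) ≤ j + (ss k + sb k) by omega)
    have h2 := w_N_succ_le k
    have h3 := w_anti (show M k + 1 ≤ j + ss k by omega)
    have h4 := w_lay_le l3
    have h5 : U (sb k + ss k) * w (j + ss k) ≤ U (sb k + ss k) * U (M k + 1) :=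
      mul_le_mul_of_nonneg_left (by linarith) hB.le
    linarith

theorem sum_conv_smul {E : Type*} [AddCommGroup E] [Module ℝ E] (M : ℕ) (q c : ℕ → ℝ) (v : ℕ → E) :
    ∑ m ∈ Finset.range (M + 1), conv M q c m • v m =
      ∑ i ∈ Finset.range (M + 1), ∑ j ∈ Finset.range (M + 1),
        if i + j ≤ M then (q i * c j) • v (i + j) else 0 := by
  simp only [conv, Finset.sum_smul]
  rw [Finset.sum_comm]
  refine Finset.sum_congr rfl fun i hi => ?_
  simp only [ite_smul, zero_smul]
  rw [← Finset.sum_filter, ← Finset.sum_filter]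
  refine Finset.sum_nbij' (fun m => m - i) (fun j => i + j) ?_ ?_ ?_ ?_ ?_
  · intro m hm; simp at hm ⊢; omega
  · intro m hm; simp at hm ⊢; omega
  · intro m hm; simp at hm ⊢; omega
  · intro m hm; simp
  · intro m hm
    simp only [Finset.mem_filter] at hm
    rw [Nat.add_sub_cancel' hm.2]

/-- A polynomial in `T` applied to a finite combination of the orbit. -/
theorem norm_poly_sub_le {k : ℕ} {q c : ℕ → ℝ} {D C η : ℝ}
    (hq : ∑ i ∈ Finset.range (M k + 1), |q i| ≤ D) (hC : ∀ j ≤ M k, |c j| ≤ C)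
    (hη : ∑ m ∈ Finset.range (M k + 1), |conv (M k) q c m - if m = N k + 1 then 1 else 0| ≤ η) :
    ‖(∑ i ∈ Finset.range (M k + 1), ∑ j ∈ Finset.range (M k + 1),
        (q i * c j) • ev (i + j + ss k)) - ev (sa k)‖ ≤
      η + D * ((M k + 1) * (C * U (M k + 1))) := by
  classical
  have hk := consts k
  have hC0 : 0 ≤ C := (abs_nonneg _).trans (hC 0 (Nat.zero_le _))
  have h1 : ev (sa k) = ∑ m ∈ Finset.range (M k + 1),
      (if m = N k + 1 then (1 : ℝ) else 0) • ev (m + ss k) := by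
    simp only [ite_smul, one_smul, zero_smul]
    rw [Finset.sum_ite_eq', if_pos (by simp; omega)]
    congr 1; omega
  have h2 : (∑ i ∈ Finset.range (M k + 1), ∑ j ∈ Finset.range (M k + 1),
        (q i * c j) • ev (i + j + ss k)) - ev (sa k) =
      (∑ m ∈ Finset.range (M k + 1),
        (conv (M k) q c m - if m = N k + 1 then 1 else 0) • ev (m + ss k)) +
      ∑ i ∈ Finset.range (M k + 1), ∑ j ∈ Finset.range (M k + 1),
        if i + j ≤ M k then 0 else (q i * c j) • ev (i + j + ss k) := by
    simp only [sub_smul]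
    rw [Finset.sum_sub_distrib, ← h1, sum_conv_smul (M k) q c (fun m => ev (m + ss k)),
      sub_add_eq_add_sub]
    congr 1
    rw [← Finset.sum_add_distrib]
    refine Finset.sum_congr rfl fun i _ => ?_
    rw [← Finset.sum_add_distrib]
    refine Finset.sum_congr rfl fun j _ => ?_
    split_ifs <;> simp
  rw [h2]
  refine (norm_add_le _ _).trans (add_le_add ?_ ?_)
  · refine (norm_sum_le _ _).trans (le_trans (Finset.sum_le_sum fun m _ => ?_) hη)
    rw [norm_smul, Real.norm_eq_abs]
    exact mul_le_of_le_one_right (abs_nonneg _) (norm_ev_le_one _)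
  · have hU := U_pos (M k + 1)
    refine (norm_sum_le _ _).trans ?_
    calc _ ≤ ∑ i ∈ Finset.range (M k + 1), |q i| * ((M k + 1) * (C * U (M k + 1))) := by
          refine Finset.sum_le_sum fun i hi => ?_
          refine (norm_sum_le _ _).trans ?_
          calc _ ≤ ∑ j ∈ Finset.range (M k + 1), |q i| * (C * U (M k + 1)) := by
                refine Finset.sum_le_sum fun j hj => ?_
                have hi' : i ≤ M k := by simpa [Nat.lt_succ_iff] using hi
                have hj' : j ≤ M k := by simpa [Nat.lt_succ_iff] using hj
                split_ifs with hij
                · rw [norm_zero]; positivity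
                · have l : Lay (i + j + ss k) := lay_between (k := k) (by omega) (by omega)
                  have l' : Lay (M k + 1) := lay_between (k := k) (by omega) (by omega)
                  rw [ev_lay l, norm_smul, norm_smul, norm_fv, mul_one, norm_mul,
                    Real.norm_eq_abs, Real.norm_eq_abs, Real.norm_of_nonneg (w_pos _).le, mul_assoc]
                  have h3 : w (i + j + ss k) ≤ U (M k + 1) := by
                    have := w_anti (show M k + 1 ≤ i + j + ss k by omega)
                    have := w_lay_le l'
                    linarith
                  refine mul_le_mul_of_nonneg_left ?_ (abs_nonneg _)
                  exact mul_le_mul (hC j hj') h3 (w_pos _).le hC0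
            _ = _ := by
                rw [Finset.sum_const, Finset.card_range, nsmul_eq_mul]
                push_cast; ring
      _ ≤ _ := by
          rw [← Finset.sum_mul]
          exact mul_le_mul_of_nonneg_right hq (by positivity)

theorem near_bound {μ B δ m D V k : ℝ} (hμ0 : 0 < μ) (hB0 : 0 < B) (hδ0 : 0 < δ) (hδ1 : δ ≤ 1)
    (hδμ : δ ≤ μ) (hM0 : 0 ≤ m) (hMk : k ≤ m) (hk0 : 0 ≤ k) (hDV0 : 0 ≤ D * V)
    (hDV : D * V ≤ (δ / (m + 3)) ^ 4) :
    (μ * B)⁻¹ * (D * (B * V + (m + 1) * (2 / δ * (2 * (B * V))))) +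
      μ⁻¹ * (δ / (k + 1) + D * ((m + 1) * (2 / δ * V))) ≤ 2 / (k + 1) := by
  have e1 : (μ * B)⁻¹ * (D * (B * V + (m + 1) * (2 / δ * (2 * (B * V))))) +
    μ⁻¹ * (δ / (k + 1) + D * ((m + 1) * (2 / δ * V))) =
    μ⁻¹ * (δ / (k + 1)) + μ⁻¹ * (D * V) * (1 + 6 * (m + 1) / δ) := by
    field_simp; ring
  rw [e1]
  have h1 : μ⁻¹ * (δ / (k + 1)) ≤ 1 / (k + 1) := by
    rw [← mul_div_assoc]
    refine div_le_div_of_nonneg_right ?_ (by positivity)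
    rw [inv_mul_le_iff₀ hμ0]; linarith
  have h2 : 1 + 6 * (m + 1) / δ ≤ (6 * m + 7) / δ := by
    rw [le_div_iff₀ hδ0, add_mul, div_mul_cancel₀ _ hδ0.ne']
    linarith
  have h3 : μ⁻¹ * (D * V) * (1 + 6 * (m + 1) / δ) ≤
      δ⁻¹ * (δ / (m + 3)) ^ 4 * ((6 * m + 7) / δ) := by
    have : μ⁻¹ ≤ δ⁻¹ := inv_anti₀ hδ0 hδμ
    gcongr
  have h4 : δ⁻¹ * (δ / (m + 3)) ^ 4 * ((6 * m + 7) / δ) = δ ^ 2 * (6 * m + 7) / (m + 3) ^ 4 := by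
    field_simp
  have h5 : δ ^ 2 * (6 * m + 7) / (m + 3) ^ 4 ≤ 1 / (k + 1) := by
    rw [div_le_div_iff₀ (by positivity) (by positivity), one_mul]
    have h6 : δ ^ 2 ≤ 1 := pow_le_one₀ hδ0.le hδ1
    calc δ ^ 2 * (6 * m + 7) * (k + 1) ≤ 1 * (6 * m + 7) * (m + 1) := by gcongr
      _ ≤ (m + 3) ^ 4 := by
        have h8 := mul_nonneg hM0 hM0
        have h9 := mul_nonneg h8 hM0
        have h10 := mul_nonneg h8 h8
        nlinarith
  have h7 : (2 : ℝ) / (k + 1) = 1 / (k + 1) + 1 / (k + 1) := by ring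
  rw [h7]
  linarith

theorem exists_near_ev_zero {J : Submodule ℝ L1} (hJ : ∀ x ∈ J, T x ∈ J) {k : ℕ} {x : L1}
    (hx : x ∈ J) (hx1 : ‖x‖ ≤ 1) (hc : ∃ j ≤ N k + 1, (1 / 2 : ℝ) ^ (N k + 2) ≤ |cf k j x|) :
    ∃ z ∈ J, ‖z - ev 0‖ ≤ 2 / (k + 1) + U (N (src k) + 1) := by
  have hk := consts k
  have hTn : ∀ n, ∀ y ∈ J, (T ^ n) y ∈ J := by
    intro n
    induction n with
    | zero => intro y hy; simpa using hy
    | succ n ih =>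
      intro y hy
      rw [pow_succ, mul_apply_eq_comp]
      exact ih _ (hJ y hy)
  set δ : ℝ := w (M k) with hδ
  have hδ0 : 0 < δ := w_pos _
  have hδ1 : δ ≤ 1 := w_le_one _
  set D : ℝ := Dk k δ with hDdef
  have hD : 0 ≤ D := Dk_nonneg k δ
  set V : ℝ := U (M k + 1) with hV
  have hV0 : 0 < V := U_pos _
  set B : ℝ := U (sb k + ss k) with hB
  have hB0 : 0 < B := U_pos _
  set μ : ℝ := U (sa k) with hμ
  have hμ0 : 0 < μ := U_pos _
  have hδμ : δ ≤ μ := by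
    have := w_fan_le (Fan.a k) (j := N (src k)) (by omega)
    exact this
  have hcb : ∀ j, |cf k j x| ≤ 2 / δ := fun j =>
    (abs_cf_le k j x).trans (mul_le_of_le_one_right (by positivity) hx1)
  obtain ⟨q, hq1, hq2⟩ := Dk_spec k hδ0 (fun j => cf k j x) (fun j _ => hcb j) hc
  let P : L1 →L[ℝ] L1 := ∑ i ∈ Finset.range (M k + 1), q i • T ^ i
  have hPa : ∀ v, P v = ∑ i ∈ Finset.range (M k + 1), q i • (T ^ i) v := fun v => by
    simp [P, sum_apply]
  have hPn : ∀ v, ‖P v‖ ≤ D * ‖v‖ := by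
    intro v
    rw [hPa]
    refine (norm_sum_le _ _).trans ?_
    calc _ ≤ ∑ i ∈ Finset.range (M k + 1), |q i| * ‖v‖ := by
          refine Finset.sum_le_sum fun i _ => ?_
          rw [norm_smul, Real.norm_eq_abs]
          exact mul_le_mul_of_nonneg_left (norm_T_pow_apply_le i v) (abs_nonneg _)
      _ ≤ _ := by
          rw [← Finset.sum_mul]
          exact mul_le_mul_of_nonneg_right hq1 (norm_nonneg _)
  set d := ss k + sb k with hd
  set y := Q k x with hy
  -- the three pieces
  have p1 : ‖(T ^ d) (x - y)‖ ≤ B * V :=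
    (norm_tail_le k x).trans (mul_le_of_le_one_right (by positivity) hx1)
  have p2 : ‖(T ^ d) y - B • (T ^ ss k) y‖ ≤ (M k + 1) * (2 / δ * (2 * (B * V))) := by
    have e : (T ^ d) y - B • (T ^ ss k) y = ∑ j ∈ Finset.range (M k + 1),
        cf k j x • ((T ^ d) (ev j) - B • (T ^ ss k) (ev j)) := by
      rw [hy, Q_apply, map_sum, map_sum, Finset.smul_sum, ← Finset.sum_sub_distrib]
      refine Finset.sum_congr rfl fun j _ => ?_
      rw [map_smul, map_smul, smul_sub, smul_comm B]
    rw [e]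
    refine (norm_sum_le _ _).trans ?_
    calc _ ≤ ∑ j ∈ Finset.range (M k + 1), 2 / δ * (2 * (B * V)) := by
          refine Finset.sum_le_sum fun j hj => ?_
          rw [norm_smul, Real.norm_eq_abs]
          exact mul_le_mul (hcb j) (norm_shift_ev_le (by simpa [Nat.lt_succ_iff] using hj))
            (norm_nonneg _) (by positivity)
      _ = _ := by
          rw [Finset.sum_const, Finset.card_range, nsmul_eq_mul]
          push_cast; ring
  have p3 : ‖P ((T ^ ss k) y) - ev (sa k)‖ ≤ δ / (k + 1) + D * ((M k + 1) * (2 / δ * V)) := by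
    have e : P ((T ^ ss k) y) = ∑ i ∈ Finset.range (M k + 1), ∑ j ∈ Finset.range (M k + 1),
        (q i * cf k j x) • ev (i + j + ss k) := by
      rw [hPa]
      refine Finset.sum_congr rfl fun i _ => ?_
      rw [hy, Q_apply, map_sum, map_sum, Finset.smul_sum]
      refine Finset.sum_congr rfl fun j _ => ?_
      rw [map_smul, map_smul, T_pow_ev, T_pow_ev, smul_smul]
      congr 2; omega
    rw [e]
    exact norm_poly_sub_le hq1 (fun j _ => hcb j) hq2
  have p4 : ‖μ⁻¹ • ev (sa k) - ev 0‖ ≤ U (N (src k) + 1) := by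
    have e1 := ev_fan (Fan.a k) (j := 0) (Nat.zero_le _)
    have e2 := w_fan (Fan.a k) 0 (Nat.zero_le _)
    simp only [add_zero, zero_add, pow_one] at e1 e2
    rw [e1, e2, smul_add, smul_smul, smul_smul, ← mul_assoc, inv_mul_cancel₀ hμ0.ne', one_mul,
      one_smul, add_sub_cancel_right, norm_smul, norm_fv, mul_one, Real.norm_of_nonneg (U_pos _).le]
  refine ⟨(μ * B)⁻¹ • P ((T ^ d) x), J.smul_mem _ ?_, ?_⟩
  · rw [hPa]
    exact J.sum_mem fun i _ => J.smul_mem _ (hTn _ _ (hTn _ _ hx))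
  have e : (μ * B)⁻¹ • P ((T ^ d) x) - ev 0 =
      (μ * B)⁻¹ • P ((T ^ d) (x - y) + ((T ^ d) y - B • (T ^ ss k) y)) +
      μ⁻¹ • (P ((T ^ ss k) y) - ev (sa k)) + (μ⁻¹ • ev (sa k) - ev 0) := by
    have e1 : (T ^ d) x = ((T ^ d) (x - y) + ((T ^ d) y - B • (T ^ ss k) y)) +
        B • (T ^ ss k) y := by
      rw [map_sub]; abel
    conv_lhs => rw [e1]
    rw [map_add P _ (B • (T ^ ss k) y), map_smul, smul_add, smul_smul, mul_inv, mul_assoc,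
      inv_mul_cancel₀ hB0.ne', mul_one, smul_sub]
    abel
  rw [e]
  refine (norm_add_le _ _).trans ?_
  have b1 : ‖(μ * B)⁻¹ • P ((T ^ d) (x - y) + ((T ^ d) y - B • (T ^ ss k) y))‖ ≤
      (μ * B)⁻¹ * (D * (B * V + (M k + 1) * (2 / δ * (2 * (B * V))))) := by
    rw [norm_smul, Real.norm_of_nonneg (by positivity)]
    refine mul_le_mul_of_nonneg_left ((hPn _).trans (mul_le_mul_of_nonneg_left ?_ hD))
      (by positivity)
    exact (norm_add_le _ _).trans (add_le_add p1 p2)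
  have b2 : ‖μ⁻¹ • (P ((T ^ ss k) y) - ev (sa k))‖ ≤
      μ⁻¹ * (δ / (k + 1) + D * ((M k + 1) * (2 / δ * V))) := by
    rw [norm_smul, Real.norm_of_nonneg (by positivity)]
    exact mul_le_mul_of_nonneg_left p3 (by positivity)
  have hDV : D * V ≤ (δ / (M k + 3)) ^ 4 := by
    have := Phi_mul_le_pow (i := M k + 1) (k := k) (n := 4) hδ0 hδ1 (by omega)
      (by have := le_N k; omega)
    have e : ((M k + 1 : ℕ) : ℝ) + 2 = M k + 3 := by push_cast; ring
    rw [e] at this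
    exact this
  have hMk : (k : ℝ) ≤ M k := by
    have : k ≤ M k := by have := le_N k; omega
    exact_mod_cast this
  have hM0 : (0 : ℝ) ≤ M k := by positivity
  set m : ℝ := (M k : ℝ) with hm
  have b3 := near_bound hμ0 hB0 hδ0 hδ1 hδμ hM0 hMk (Nat.cast_nonneg k)
    (mul_nonneg hD hV0.le) hDV
  have b4 := norm_add_le ((μ * B)⁻¹ • P ((T ^ d) (x - y) + ((T ^ d) y - B • (T ^ ss k) y)))
    (μ⁻¹ • (P ((T ^ ss k) y) - ev (sa k)))
  linarith

theorem cf_eq {k j i₀ : ℕ} (hj : j ≤ M k) (hi₀ : i₀ ≤ M k)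
    (h : ∀ i, (i ≤ M k ∨ Bad k i) → cc i ≠ 0 → rho i = j → i = i₀) (x : L1) :
    cf k j x = x j / w j - if rho i₀ = j then cc i₀ / w i₀ * x i₀ else 0 := by
  classical
  have e : cf k j = (w j)⁻¹ • coord j -
      (if rho i₀ = j then cc i₀ / w i₀ else 0) • coord i₀ := by
    refine clm_ext fun i => ?_
    rw [cf_fv, sub_apply, smul_apply, smul_apply,
      coord_fv, coord_fv, smul_eq_mul, smul_eq_mul, gam]
    by_cases h1 : i ≤ M k ∨ Bad k i
    · rw [if_pos h1, sub_div]
      congr 1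
      · by_cases h2 : j = i
        · subst h2
          rw [if_pos ⟨hj, rfl⟩, if_pos rfl, mul_one, one_div]
        · rw [if_neg (fun hh => h2 hh.2), if_neg h2, zero_div, mul_zero]
      · by_cases h2 : j = rho i
        · rw [if_pos h2]
          by_cases h3 : cc i = 0
          · by_cases h4 : i₀ = i
            · subst h4; simp [h3]
            · simp [h3, h4]
          · have h4 := h i h1 h3 h2.symm
            subst h4
            rw [if_pos h2.symm, if_pos rfl, mul_one]
        · rw [if_neg h2]
          by_cases h4 : i₀ = i
          · subst h4; simp [Ne.symm h2]
          · simp [h4]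
    · rw [if_neg h1, if_neg (fun hh : j = i => h1 (Or.inl (hh ▸ hj))),
        if_neg (fun hh : i₀ = i => h1 (Or.inl (hh ▸ hi₀)))]
      simp
  rw [e, sub_apply, smul_apply, smul_apply, coord_apply,
    coord_apply, smul_eq_mul, smul_eq_mul, ite_mul, zero_mul, div_eq_inv_mul (x j)]

theorem exists_fan_of_cc_ne_zero {i : ℕ} (h : cc i ≠ 0) :
    ∃ σ p q r, Fan σ p q ∧ r ≤ q - p ∧ i = σ + r := by
  rcases Nat.eq_zero_or_pos i with rfl | hi
  · exact absurd cc_zero h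
  rcases lay_or_fan hi with h' | h'
  · exact absurd (cc_lay h') h
  · exact h'

/-- Preimages under `rho` of the indices of step `k`, as seen from step `k + 1`. -/
theorem eq_of_rho_eq {k i j : ℕ} (h1 : src (k + 1) ≤ k) (h2 : ∀ k', src k' ≠ k + 1)
    (hj : N k < j) (hi : i ≤ M (k + 1) ∨ Bad (k + 1) i) (hc : cc i ≠ 0) (hr : rho i = j) :
    i = sb k + j ∧ j ≤ M k := by
  rcases hi with hi | ⟨k', h3, h4, t, ht, rfl⟩
  · obtain ⟨σ, p, q, r, hF, hr', rfl⟩ := exists_fan_of_cc_ne_zero hc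
    rw [rho_fan hF hr'] at hr
    have hk1 := consts (k + 1)
    cases hF with
    | a K =>
      have hK := consts K
      have h5 : K < k + 2 := by
        by_contra h6
        have := N_mono (show k + 1 + 1 ≤ K by omega)
        omega
      have h6 : src K ≤ k := by
        rcases (show K ≤ k ∨ K = k + 1 by omega) with h | rfl
        · exact (src_le K).trans h
        · exact h1
      have := N_mono h6
      omega
    | b K =>
      have hK := consts K
      have h5 : K < k + 1 := by
        by_contra h6
        rcases (show K = k + 1 ∨ k + 1 + 1 ≤ K by omega) with rfl | h
        · omega
        · have := N_mono h
          omega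
      have h6 : k ≤ K := by
        by_contra h7
        have := N_mono (show K + 1 ≤ k by omega)
        omega
      obtain rfl : K = k := by omega
      omega
  · have hF := Fan.a k'
    rw [rho_fan hF (by omega)] at hr
    have h5 := h2 k'
    have := N_mono (show src k' ≤ k by omega)
    omega

/-- Coordinates in the first copy made at step `k` are controlled by the functionals of
step `k + 1`. -/
theorem abs_div_w_le {k : ℕ} {x : L1} {η : ℝ} (h1 : src (k + 1) ≤ k) (h2 : ∀ k', src k' ≠ k + 1)
    (hx : ∀ j ≤ N (k + 1) + 1, |cf (k + 1) j x| ≤ η) {i : ℕ} (hi : ss k ≤ i) (hi' : i ≤ M k) :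
    |x i| / w i ≤ 2 * η := by
  have hk := consts k
  have hk1 := consts (k + 1)
  have a1 := cf_eq (k := k + 1) (j := i) (i₀ := sb k + i) (by omega) (by omega)
    (fun l hl hc hr => (eq_of_rho_eq h1 h2 (by omega) hl hc hr).1) x
  have a2 := cf_eq (k := k + 1) (j := sb k + i) (i₀ := 0) (by omega) (by omega)
    (fun l hl hc hr => by
      have := (eq_of_rho_eq h1 h2 (by omega) hl hc hr).2
      omega) x
  rw [cc_zero, zero_div, zero_mul, ite_self, sub_zero] at a2
  have hr : rho (sb k + i) = i := by
    have := rho_fan (Fan.b k) (j := i - ss k) (by omega)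
    rw [show sb k + ss k + (i - ss k) = sb k + i by omega] at this
    omega
  rw [if_pos hr, div_mul_eq_mul_div, mul_div_assoc, ← a2] at a1
  have b1 := hx i (by omega)
  have b2 := hx (sb k + i) (by omega)
  have e : |x i| / w i = |cf (k + 1) i x + cc (sb k + i) * cf (k + 1) (sb k + i) x| := by
    rw [a1, sub_add_cancel, abs_div, abs_of_pos (w_pos i)]
  rw [e]
  refine (abs_add_le _ _).trans ?_
  rw [abs_mul, abs_of_nonneg (cc_nonneg _), two_mul]
  exact add_le_add b1 ((mul_le_of_le_one_left (abs_nonneg _) (cc_le_one _)).trans b2)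

theorem cf_copy {k t : ℕ} (ht : t ≤ N (src k)) (x : L1) :
    cf k (sa k + t) x = x (sa k + t) / w (sa k + t) := by
  have hk := consts k
  rw [cf_eq (i₀ := 0) (by omega) (by omega), cc_zero, zero_div, zero_mul, ite_self, sub_zero]
  intro i hi hc hr
  exfalso
  rcases hi with hi | hi
  · obtain ⟨σ, p, q, r, hF, hr', rfl⟩ := exists_fan_of_cc_ne_zero hc
    rw [rho_fan hF hr'] at hr
    have hk1 := consts (k + 1)
    cases hF with
    | a K =>
      have hK := consts K
      have h5 : K < k + 1 := by
        by_contra h6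
        have := N_mono (show k + 1 ≤ K by omega)
        omega
      have := N_mono (show K ≤ k by omega)
      omega
    | b K =>
      have hK := consts K
      have h5 : K < k := by
        by_contra h6
        rcases (show K = k ∨ k + 1 ≤ K by omega) with rfl | h
        · omega
        · have := N_mono h
          omega
      have := N_mono (show K + 1 ≤ k by omega)
      omega
  · have := hi.rho_le
    omega

/-- The tail of a fixed summable majorant. -/
def tailBd (K : ℝ) (x : L1) (n i : ℕ) : ℝ := if i ≤ n then 0 else K * |x i| + (1 / 2) ^ i

theorem summable_bd (K : ℝ) (x : L1) : Summable fun i => K * |x i| + (1 / 2 : ℝ) ^ i :=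
  ((L1_summable_abs x).mul_left K).add summable_geometric_two

theorem tailBd_nonneg {K : ℝ} (hK : 0 ≤ K) (x : L1) (n i : ℕ) : 0 ≤ tailBd K x n i := by
  unfold tailBd; split_ifs <;> positivity

theorem norm_tailBd_le {K : ℝ} (hK : 0 ≤ K) (x : L1) (n i : ℕ) :
    ‖tailBd K x n i‖ ≤ K * |x i| + (1 / 2) ^ i := by
  rw [Real.norm_of_nonneg (tailBd_nonneg hK x n i)]
  unfold tailBd; split_ifs
  · positivity
  · exact le_rfl

theorem summable_tailBd {K : ℝ} (hK : 0 ≤ K) (x : L1) (n : ℕ) : Summable (tailBd K x n) :=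
  Summable.of_norm_bounded (summable_bd K x) (norm_tailBd_le hK x n)

theorem tendsto_tailBd {K : ℝ} (hK : 0 ≤ K) (x : L1) :
    Tendsto (fun n => ∑' i, tailBd K x n i) atTop (𝓝 0) := by
  have := tendsto_tsum_of_dominated_convergence (f := tailBd K x) (g := fun _ => 0) (𝓕 := atTop)
    (summable_bd K x) (fun i => by
      refine tendsto_const_nhds.congr' ?_
      filter_upwards [eventually_ge_atTop i] with n hn
      rw [tailBd, if_pos hn]) (Eventually.of_forall fun n i => norm_tailBd_le hK x n i)
  simpa using this

theorem abs_coord_ev_le (j i : ℕ) : |coord j (ev i)| ≤ 1 := by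
  have h := norm_clm_apply_le (coord j) (K := 1) (fun i => by
    rw [coord_fv]; split_ifs <;> simp) (ev i)
  rw [one_mul, Real.norm_eq_abs] at h
  exact h.trans (norm_ev_le_one i)

theorem abs_coord_Q_le {k j : ℕ} (hj : j ≤ N k) {x : L1} {η : ℝ}
    (hx : ∀ j ≤ N k + 1, |cf k j x| ≤ η) :
    |coord j (Q k x)| ≤ (N k + 1) * η + ∑' i, tailBd (1 / w (N (src k) + 1)) x (N k) i := by
  have hk := consts k
  set K := 1 / w (N (src k) + 1) with hKd
  have hK : 0 ≤ K := by have := w_pos (N (src k) + 1); positivity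
  have hη : 0 ≤ η := (abs_nonneg _).trans (hx 0 (Nat.zero_le _))
  have e1 : M k + 1 = (N k + 1) + (M k - N k) := by omega
  rw [Q_apply, e1, Finset.sum_range_add, map_add, map_sum, map_sum]
  refine (abs_add_le _ _).trans (add_le_add ?_ ?_)
  · refine (Finset.abs_sum_le_sum_abs _ _).trans ?_
    calc _ ≤ ∑ i ∈ Finset.range (N k + 1), η := by
          refine Finset.sum_le_sum fun i hi => ?_
          rw [map_smul, smul_eq_mul, abs_mul]
          have hi' : i < N k + 1 := by simpa using hi
          exact (mul_le_of_le_one_right (abs_nonneg _) (abs_coord_ev_le j i)).trans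
            (hx i (by omega))
      _ = _ := by
          rw [Finset.sum_const, Finset.card_range, nsmul_eq_mul]
          push_cast; ring
  · refine (Finset.abs_sum_le_sum_abs _ _).trans ?_
    have hs := summable_tailBd hK x (N k)
    have e2 : ∑ i ∈ Finset.range (M k - N k), tailBd K x (N k) (N k + 1 + i) ≤
        ∑' i, tailBd K x (N k) i := by
      have := hs.sum_le_tsum (Finset.range (M k + 1)) (fun i _ => tailBd_nonneg hK x (N k) i)
      rw [e1, Finset.sum_range_add] at this
      have h0 : 0 ≤ ∑ i ∈ Finset.range (N k + 1), tailBd K x (N k) i :=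
        Finset.sum_nonneg fun i _ => tailBd_nonneg hK x (N k) i
      linarith
    refine (Finset.sum_le_sum fun r hr => ?_).trans e2
    have hr' : r < M k - N k := by simpa using hr
    rw [map_smul, smul_eq_mul, abs_mul]
    by_cases hl : N k + 1 + r < sa k
    · have : coord j (ev (N k + 1 + r)) = 0 := by
        rw [ev_lay (lay_before (k := k) (by omega) hl), map_smul, coord_fv, if_neg (by omega),
          smul_zero]
      rw [this, abs_zero, mul_zero]
      exact tailBd_nonneg hK x _ _
    · obtain ⟨t, ht⟩ : ∃ t, N k + 1 + r = sa k + t := ⟨N k + 1 + r - sa k, by omega⟩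
      have ht' : t ≤ N (src k) := by omega
      rw [ht, cf_copy ht', ev_eq, map_add, map_smul, map_smul, coord_fv, if_neg (by omega),
        smul_zero, zero_add, smul_eq_mul, abs_mul, abs_of_nonneg (cc_nonneg _), abs_div,
        abs_of_pos (w_pos _), tailBd, if_neg (by omega)]
      have h1 := cc_div_w_le ht'
      have h2 := abs_coord_ev_le j (rho (sa k + t))
      calc |x (sa k + t)| / w (sa k + t) * (cc (sa k + t) * |coord j (ev (rho (sa k + t)))|)
          = |x (sa k + t)| * (cc (sa k + t) / w (sa k + t)) *
              |coord j (ev (rho (sa k + t)))| := by ring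
        _ ≤ |x (sa k + t)| * (cc (sa k + t) / w (sa k + t)) := by
            refine mul_le_of_le_one_right ?_ h2
            have := cc_nonneg (sa k + t)
            have := w_pos (sa k + t)
            positivity
        _ ≤ |x (sa k + t)| * K := mul_le_mul_of_nonneg_left h1 (abs_nonneg _)
        _ ≤ _ := by
            rw [mul_comm]
            have : (0 : ℝ) ≤ (1 / 2) ^ (sa k + t) := by positivity
            linarith

theorem abs_coord_sub_Q_le {k j l : ℕ} (hj : j ≤ N k) {x : L1}
    (hx : ∀ k', k < k' → l < src k' → ∀ t ≤ N (src k'),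
      |x (sa k' + t)| / w (sa k' + t) ≤ (1 / 2) ^ (sa k' + t)) :
    |coord j (x - Q k x)| ≤ ∑' i, tailBd (1 / w (N l + 1)) x (N k) i := by
  have hk := consts k
  set K := 1 / w (N l + 1) with hKd
  have hK : 0 ≤ K := by have := w_pos (N l + 1); positivity
  have e : coord j (x - Q k x) = (coord j - (coord j).comp (Q k)) x := by
    rw [sub_apply, ContinuousLinearMap.comp_apply, map_sub]
  rw [e, ← Real.norm_eq_abs]
  refine norm_clm_le_tsum _ x (summable_tailBd hK x (N k)) fun i => ?_
  rw [sub_apply, ContinuousLinearMap.comp_apply]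
  by_cases hi : i ≤ M k
  · rw [Q_fv_le hi, sub_self, norm_zero, mul_zero]
    exact tailBd_nonneg hK x _ _
  have h0 : coord j (fv i) = 0 := by rw [coord_fv, if_neg (by omega)]
  by_cases hb : Bad k i
  · rw [Q_fv_bad hb, h0, map_neg, sub_neg_eq_add, zero_add, map_smul, norm_smul,
      Real.norm_eq_abs, Real.norm_eq_abs, tailBd, if_neg (by omega)]
    have hw := w_pos i
    have hc := cc_nonneg i
    rw [abs_of_nonneg (show 0 ≤ cc i / w i by positivity)]
    have h2 : |x i| * (cc i / w i * |coord j (ev (rho i))|) ≤ |x i| * (cc i / w i) :=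
      mul_le_mul_of_nonneg_left (mul_le_of_le_one_right (by positivity)
        (abs_coord_ev_le j _)) (abs_nonneg _)
    have h3 : (0 : ℝ) ≤ (1 / 2) ^ i := by positivity
    have h4 : 0 ≤ K * |x i| := by positivity
    refine h2.trans ?_
    obtain ⟨k', h5, h6, t, ht, rfl⟩ := hb
    rcases lt_or_ge l (src k') with h7 | h7
    · have h8 := hx k' h5 h7 t ht
      have h9 : |x (sa k' + t)| * (cc (sa k' + t) / w (sa k' + t)) ≤
          |x (sa k' + t)| / w (sa k' + t) := by
        rw [mul_div_assoc', div_le_div_iff_of_pos_right hw]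
        exact mul_le_of_le_one_right (abs_nonneg _) (cc_le_one _)
      linarith
    · have h8 : cc (sa k' + t) / w (sa k' + t) ≤ K :=
        (cc_div_w_le ht).trans (one_div_le_one_div_of_le (w_pos _)
          (w_anti (by have := N_mono h7; omega)))
      have := mul_le_mul_of_nonneg_left h8 (abs_nonneg (x (sa k' + t)))
      linarith [mul_comm K |x (sa k' + t)|]
  · rw [Q_fv_else hi hb, h0, map_zero, sub_zero, norm_zero, mul_zero]
    exact tailBd_nonneg hK x _ _

/-- A vector all of whose coefficient functionals are small vanishes. -/
theorem eq_zero_of_cf_small {x : L1} {k₁ p : ℕ}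
    (hx : ∀ k, k₁ ≤ k → tri p ≤ src k → ∀ j ≤ N k + 1, |cf k j x| ≤ (1 / 2) ^ (N k + 2)) :
    x = 0 := by
  set l := tri p with hl
  have hsmall : ∀ k', k₁ ≤ k' → l < src k' → ∀ t ≤ N (src k'),
      |x (sa k' + t)| / w (sa k' + t) ≤ (1 / 2) ^ (sa k' + t) := by
    intro k' hk' hs t ht
    obtain ⟨h1, h2, h3⟩ := src_succ_of_lt hs
    have hk := consts k'
    refine (abs_div_w_le h2 h3 (hx (k' + 1) (by omega) h1) (by omega) (by omega)).trans ?_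
    rw [pow_succ, mul_comm, mul_assoc, one_div_mul_cancel two_ne_zero, mul_one]
    exact pow_le_pow_of_le_one (by norm_num) (by norm_num) (by omega)
  set K := 1 / w (N l + 1) with hKd
  have hK : 0 ≤ K := by have := w_pos (N l + 1); positivity
  have hlim : Tendsto (fun n : ℕ => ((n : ℝ) + 1) * (1 / 2) ^ (n + 2) +
      2 * ∑' i, tailBd K x n i) atTop (𝓝 0) := by
    have a1 := tendsto_self_mul_const_pow_of_lt_one (r := (1 / 2 : ℝ)) (by norm_num) (by norm_num)
    have a2 := tendsto_pow_atTop_nhds_zero_of_lt_one (r := (1 / 2 : ℝ)) (by norm_num) (by norm_num)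
    have a3 := ((a1.add a2).const_mul (1 / 4)).add ((tendsto_tailBd hK x).const_mul 2)
    simp only [add_zero, mul_zero] at a3
    refine a3.congr fun n => ?_
    ring
  ext j
  change x j = 0
  rw [← abs_eq_zero]
  refine le_antisymm (le_of_forall_pos_le_add fun ε hε => ?_) (abs_nonneg _)
  obtain ⟨n, hn⟩ := eventually_atTop.1 (hlim.eventually (gt_mem_nhds hε))
  obtain ⟨k, hk, hsk⟩ := exists_src_eq p (n + k₁ + j)
  rw [← hl] at hsk
  have hkN := le_N k
  have b1 := abs_coord_Q_le (k := k) (j := j) (by omega) (hx k (by omega) hsk.ge)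
  have b2 := abs_coord_sub_Q_le (k := k) (j := j) (l := l) (x := x) (by omega)
    (fun k' h => hsmall k' (by omega))
  rw [hsk] at b1
  have b3 := hn (N k) (by omega)
  have b4 := abs_add_le (coord j (x - Q k x)) (coord j (Q k x))
  rw [map_sub, sub_add_cancel, coord_apply] at b4
  rw [map_sub, coord_apply] at b2
  linarith

theorem no_invariant_subspace : ¬ ∃ J : Submodule ℝ L1, IsClosed (J : Set L1) ∧ J ≠ ⊥ ∧ J ≠ ⊤ ∧
    ∀ x ∈ J, T x ∈ J := by
  rintro ⟨J, hcl, hbot, htop, hJ⟩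
  have h0 : ev 0 ∉ J := by
    intro h
    have hev : ∀ n, ev n ∈ J := by
      intro n
      induction n with
      | zero => exact h
      | succ n ih => rw [← T_ev]; exact hJ _ ih
    refine htop (eq_top_of_fv_mem hcl fun i => ?_)
    rw [fv_eq]
    exact J.smul_mem _ (J.sub_mem (hev _) (J.smul_mem _ (hev _)))
  obtain ⟨ε, hε, hball⟩ := Metric.isOpen_iff.1 hcl.isOpen_compl (ev 0) h0
  have hfar : ∀ z ∈ J, ε ≤ ‖z - ev 0‖ := by
    intro z hz
    by_contra hlt
    push Not at hlt
    exact hball (by rwa [Metric.mem_ball, dist_eq_norm]) hz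
  obtain ⟨y, hy, hy0⟩ := (Submodule.ne_bot_iff J).1 hbot
  obtain ⟨n, hn⟩ := exists_nat_gt (3 / ε)
  refine hy0 ?_
  set x : L1 := (‖y‖)⁻¹ • y with hxd
  have hyn : 0 < ‖y‖ := norm_pos_iff.2 hy0
  have hx1 : ‖x‖ ≤ 1 := by
    rw [hxd, norm_smul, norm_inv, norm_norm, inv_mul_cancel₀ hyn.ne']
  have hx0 : x = 0 := by
    refine eq_zero_of_cf_small (k₁ := n) (p := n) fun k hk hs j hj => ?_
    by_contra hlt
    push Not at hlt
    obtain ⟨z, hz, hzn⟩ := exists_near_ev_zero hJ (J.smul_mem _ hy) hx1 ⟨j, hj, hlt.le⟩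
    have h1 := hfar z hz
    have h2 := U_le_inv (N (src k) + 1)
    have hn0 : (0 : ℝ) < n := lt_of_le_of_lt (by positivity) hn
    have hkn : (n : ℝ) ≤ k := by exact_mod_cast hk
    have hNn : (n : ℝ) ≤ N (src k) := by
      have := tri_strictMono.le_apply (x := n)
      have := le_N (src k)
      exact_mod_cast (show n ≤ N (src k) by omega)
    have h3 : (2 : ℝ) / (k + 1) ≤ 2 / n :=
      div_le_div_of_nonneg_left (by norm_num) hn0 (by linarith)
    have h4 : 1 / (((N (src k) + 1 : ℕ) : ℝ) + 2) ≤ 1 / n :=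
      one_div_le_one_div_of_le hn0 (by push_cast; linarith)
    have h5 : 2 / (n : ℝ) + 1 / n < ε := by
      rw [← add_div, div_lt_iff₀ hn0]
      rw [div_lt_iff₀ hε] at hn
      linarith
    linarith
  rw [hxd, smul_eq_zero] at hx0
  exact hx0.resolve_left (inv_ne_zero hyn.ne')

end ReadOp

end

/-- There exists a quasinilpotent bounded operator `T` on `ℓ¹` with no nontrivial
closed invariant subspace whose negative part `T⁻` is compact (C. J. Read's operator). -/
theorem exists_quasinilpotent_no_invariant_subspace_with_compact_negative_part :
    ∃ T : lp (fun _ : ℕ => ℝ) 1 →L[ℝ] lp (fun _ : ℕ => ℝ) 1,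
      -- `T` is quasinilpotent
      Tendsto (fun n : ℕ => ‖T ^ n‖ ^ (1 / (n : ℝ))) atTop (nhds 0) ∧
      -- `T` has no nontrivial closed invariant subspace
      (¬ ∃ J : Submodule ℝ (lp (fun _ : ℕ => ℝ) 1),
        IsClosed (J : Set (lp (fun _ : ℕ => ℝ) 1)) ∧ J ≠ ⊥ ∧ J ≠ ⊤ ∧
        ∀ x ∈ J, T x ∈ J) ∧
      -- the negative part `T⁻` is compact
      (∃ Tneg : lp (fun _ : ℕ => ℝ) 1 →L[ℝ] lp (fun _ : ℕ => ℝ) 1,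
        (∀ i j : ℕ, Tneg (lp.single 1 j 1) i = max (-(T (lp.single 1 j 1) i)) 0) ∧
        IsCompactOperator Tneg) := by
  exact ⟨ReadOp.T, ReadOp.tendsto_norm_pow, ReadOp.no_invariant_subspace, ReadOp.exists_compact_neg⟩
end
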